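/- arXiv:2010.02717 — 2 statements merged into one kernel-verified Lean document; each statement's English description precedes it below -/
import Mathlib

section
/- For every α ∈ (0,1) there exists a constant C_α > 0 such that for every integer k ≥ 1 the best uniform rational approximation error satisfies E_{α,k} ≤ C_α · e^{−2π√(kα)}. -/
open Real Set

/-- The best uniform rational approximation (BURA) error `E_{q,α,k}` of
`g_q(z;α) = z^α/(1 + q z^α)` on `[0,1]` by rational functions `P/Q` with
`deg P, deg Q ≤ k` and `Q` nonvanishing on `[0,1]`. -/
noncomputable def buraError (q α : ℝ) (k : ℕ) : ℝ :=
  sInf { e : ℝ | ∃ P Q : Polynomial ℝ, P.natDegree ≤ k ∧ Q.natDegree ≤ k ∧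
    (∀ z ∈ Set.Icc (0:ℝ) 1, Q.eval z ≠ 0) ∧
    e = ⨆ z : Set.Icc (0:ℝ) 1,
      |P.eval (z : ℝ) / Q.eval (z : ℝ) - (z : ℝ) ^ α / (1 + q * (z : ℝ) ^ α)| }

/-- The node-counting function in the logarithmic variable: close to `10 y` for `y < 0` and to
`α y² / (4π²) + 10 y` for `y > 0`. -/
noncomputable def nodePhase (α y : ℝ) : ℝ :=
  α / (4 * π ^ 2) * (y ^ 2 / (1 + Real.exp (-y / 6))) + 10 * y

/-- The derivative of `nodePhase`. -/
noncomputable def nodeDensity (α y : ℝ) : ℝ :=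
  α / (4 * π ^ 2) * ((2 * y * (1 + Real.exp (-y / 6)) + y ^ 2 * (Real.exp (-y / 6) / 6)) /
    (1 + Real.exp (-y / 6)) ^ 2) + 10

/-- The analytic continuation of `nodePhase` to the strip `|Im w| < 3π`. -/
noncomputable def nodePhaseC (α : ℝ) (w : ℂ) : ℂ :=
  ((α / (4 * π ^ 2) : ℝ) : ℂ) * (w ^ 2 / (1 + Complex.exp (-w / 6))) + 10 * w

lemma nodePhaseC_ofReal (α y : ℝ) : nodePhaseC α y = (nodePhase α y : ℂ) := by
  simp [nodePhaseC, nodePhase]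

lemma hasDerivAt_nodePhase (α y : ℝ) : HasDerivAt (nodePhase α) (nodeDensity α y) y := by
  have hT : (1 + Real.exp (-y / 6)) ≠ 0 := by positivity
  have h1 : HasDerivAt (fun y : ℝ => 1 + Real.exp (-y / 6))
      (Real.exp (-y / 6) * (-1 / 6)) y :=
    (((hasDerivAt_id y).neg.div_const 6).exp).const_add 1
  have h2 := (((hasDerivAt_pow 2 y).div h1 hT).const_mul (α / (4 * π ^ 2))).add
    ((hasDerivAt_id y).const_mul 10)
  refine h2.congr_deriv ?_
  rw [nodeDensity]
  congr 1
  · congr 2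
    push_cast
    ring
  · ring

lemma continuous_nodeDensity (α : ℝ) : Continuous (nodeDensity α) := by
  unfold nodeDensity
  refine (continuous_const.mul (Continuous.div (by fun_prop) (by fun_prop) ?_)).add
    continuous_const
  intro y
  positivity

lemma coeff_le {α : ℝ} (h1 : α < 1) : α / (4 * π ^ 2) ≤ 1 / 36 := by
  have := Real.pi_gt_three
  rw [div_le_div_iff₀ (by positivity) (by norm_num)]
  nlinarith

lemma one_le_nodeDensity {α : ℝ} (h0 : 0 < α) (h1 : α < 1) (y : ℝ) : 1 ≤ nodeDensity α y := by
  have hc := coeff_le h1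
  have hc0 : 0 < α / (4 * π ^ 2) := by positivity
  have he := Real.exp_pos (-y / 6)
  have hx := Real.add_one_le_exp (-y / 6)
  have key : -12 ≤ (2 * y * (1 + Real.exp (-y / 6)) + y ^ 2 * (Real.exp (-y / 6) / 6)) /
      (1 + Real.exp (-y / 6)) ^ 2 := by
    rw [le_div_iff₀ (by positivity)]
    nlinarith [mul_pos he he, mul_nonneg (sq_nonneg y) he.le]
  rw [nodeDensity]
  nlinarith

lemma sq_mul_exp_neg_le (a : ℝ) (ha : 0 ≤ a) : (a ^ 2 + 100) * Real.exp (-a / 6) ≤ 172 := by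
  have h := Real.quadratic_le_exp_of_nonneg (x := a / 6) (by positivity)
  rw [neg_div, Real.exp_neg, ← div_eq_mul_inv, div_le_iff₀ (Real.exp_pos _)]
  nlinarith

lemma exp_neg_re_nonneg {w : ℂ} (h : |w.im| < 3 * π) : 0 ≤ (Complex.exp (-w / 6)).re := by
  have e : -w / 6 = ((-1 / 6 : ℝ) : ℂ) * w := by push_cast; ring
  rw [Complex.exp_re, e, Complex.re_ofReal_mul, Complex.im_ofReal_mul]
  rw [abs_lt] at h
  exact mul_nonneg (Real.exp_pos _).le
    (Real.cos_nonneg_of_mem_Icc ⟨by linarith [h.1], by linarith [h.1]⟩)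

lemma norm_exp_neg_div (w : ℂ) : ‖Complex.exp (-w / 6)‖ = Real.exp (-w.re / 6) := by
  have e : -w / 6 = ((-1 / 6 : ℝ) : ℂ) * w := by push_cast; ring
  rw [Complex.norm_exp, e, Complex.re_ofReal_mul]
  congr 1; ring

lemma one_le_norm_one_add {t : ℂ} (h : 0 ≤ t.re) : 1 ≤ ‖1 + t‖ := by
  refine le_trans ?_ (Complex.re_le_norm _)
  simpa using h

lemma norm_le_norm_one_add {t : ℂ} (h : 0 ≤ t.re) : ‖t‖ ≤ ‖1 + t‖ := by
  rw [Complex.norm_def, Complex.norm_def]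
  apply Real.sqrt_le_sqrt
  simp only [Complex.normSq_apply, Complex.add_re, Complex.add_im, Complex.one_re, Complex.one_im]
  nlinarith

lemma one_add_exp_neg_ne_zero {w : ℂ} (h : |w.im| < 3 * π) : 1 + Complex.exp (-w / 6) ≠ 0 := by
  have := one_le_norm_one_add (exp_neg_re_nonneg h)
  intro h0
  rw [h0, norm_zero] at this
  linarith

lemma nodePhaseC_im_ge {α : ℝ} (h0 : 0 < α) (h1 : α < 1) {w : ℂ} (hw0 : 0 ≤ w.im)
    (hw : w.im < 3 * π) :
    α / (4 * π ^ 2) * (2 * w.im * max w.re 0) - 5 + 10 * w.im ≤ (nodePhaseC α w).im := by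
  have hc := coeff_le h1
  have hc0 : 0 < α / (4 * π ^ 2) := by positivity
  have habs : |w.im| < 3 * π := by rwa [abs_of_nonneg hw0]
  have hre := exp_neg_re_nonneg habs
  have hn1 := one_le_norm_one_add hre
  have hn2 := norm_le_norm_one_add hre
  have hne := one_add_exp_neg_ne_zero habs
  have hsq : ‖w ^ 2‖ ≤ w.re ^ 2 + 100 := by
    rw [norm_pow, ← Complex.normSq_eq_norm_sq, Complex.normSq_apply]
    have := Real.pi_lt_d2
    nlinarith
  have key : 2 * w.im * max w.re 0 - 172 ≤ (w ^ 2 / (1 + Complex.exp (-w / 6))).im := by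
    rcases le_total 0 w.re with ha | ha
    · rw [max_eq_left ha]
      have e : w ^ 2 / (1 + Complex.exp (-w / 6)) =
          w ^ 2 - w ^ 2 * Complex.exp (-w / 6) / (1 + Complex.exp (-w / 6)) := by
        rw [eq_sub_iff_add_eq, ← add_div, div_eq_iff hne]
        ring
      have hb : ‖w ^ 2 * Complex.exp (-w / 6) / (1 + Complex.exp (-w / 6))‖ ≤ 172 := by
        rw [norm_div, norm_mul, norm_exp_neg_div]
        refine (div_le_self (by positivity) hn1).trans ?_
        exact (mul_le_mul_of_nonneg_right hsq (Real.exp_pos _).le).trans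
          (sq_mul_exp_neg_le _ ha)
      have := (Complex.abs_im_le_norm _).trans hb
      rw [abs_le] at this
      rw [e, Complex.sub_im]
      have e2 : (w ^ 2).im = 2 * w.im * w.re := by
        rw [pow_two, Complex.mul_im]; ring
      rw [e2]
      linarith [this.2]
    · rw [max_eq_right ha]
      have hb : ‖w ^ 2 / (1 + Complex.exp (-w / 6))‖ ≤ 172 := by
        rw [norm_exp_neg_div] at hn2
        rw [norm_div]
        refine (div_le_div₀ (by positivity) hsq (Real.exp_pos _) hn2).trans ?_
        have := sq_mul_exp_neg_le (-w.re) (by linarith)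
        rwa [neg_sq, neg_neg, ← neg_neg (w.re / 6), Real.exp_neg,
          ← div_eq_mul_inv, ← neg_div] at this
      have := (Complex.abs_im_le_norm _).trans hb
      rw [abs_le] at this
      linarith [this.1]
  have e3 : (nodePhaseC α w).im = α / (4 * π ^ 2) * (w ^ 2 / (1 + Complex.exp (-w / 6))).im
      + 10 * w.im := by
    rw [nodePhaseC, Complex.add_im, Complex.im_ofReal_mul]
    simp
  rw [e3]
  nlinarith [mul_le_mul_of_nonneg_left key hc0.le]

lemma differentiableAt_nodePhaseC (α : ℝ) {w : ℂ} (hw : |w.im| < 3 * π) :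
    DifferentiableAt ℂ (nodePhaseC α) w := by
  have := one_add_exp_neg_ne_zero hw
  unfold nodePhaseC
  fun_prop (disch := assumption)

lemma nodePhase_le {α : ℝ} (h0 : 0 < α) (y : ℝ) :
    nodePhase α y ≤ α / (4 * π ^ 2) * y ^ 2 + 10 * y := by
  rw [nodePhase]
  gcongr
  exact div_le_self (sq_nonneg y) (by linarith [Real.exp_pos (-y / 6)])

lemma le_nodePhase {α : ℝ} (h0 : 0 < α) (y : ℝ) : 10 * y ≤ nodePhase α y := by
  rw [nodePhase]
  have : 0 ≤ α / (4 * π ^ 2) * (y ^ 2 / (1 + Real.exp (-y / 6))) := by positivity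
  linarith

lemma strictMono_nodePhase {α : ℝ} (h0 : 0 < α) (h1 : α < 1) : StrictMono (nodePhase α) :=
  strictMono_of_hasDerivAt_pos (hasDerivAt_nodePhase α)
    fun y => one_pos.trans_le (one_le_nodeDensity h0 h1 y)

lemma continuous_nodePhase (α : ℝ) : Continuous (nodePhase α) :=
  continuous_iff_continuousAt.2 fun y => (hasDerivAt_nodePhase α y).continuousAt

lemma surjective_nodePhase {α : ℝ} (h0 : 0 < α) :
    Function.Surjective (nodePhase α) := by
  refine (continuous_nodePhase α).surjective ?_ ?_
  · exact Filter.tendsto_atTop_mono (le_nodePhase h0)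
      (Filter.tendsto_id.const_mul_atTop (by norm_num))
  · refine Filter.tendsto_atBot_mono' _ (?_ : nodePhase α ≤ᶠ[Filter.atBot]
      fun y : ℝ => 10 * y + α / (4 * π ^ 2) * 172) ?_
    · filter_upwards [Filter.eventually_le_atBot 0] with y hy
      have hT : y ^ 2 / (1 + Real.exp (-y / 6)) ≤ 172 := by
        rw [div_le_iff₀ (by positivity)]
        have h := Real.quadratic_le_exp_of_nonneg (x := -y / 6) (by linarith)
        nlinarith
      rw [nodePhase, add_comm]
      gcongr
    · exact Filter.tendsto_atBot_add_const_right _ _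
        (Filter.tendsto_id.const_mul_atBot (by norm_num))

/-- A contour integral over a horizontal line may be moved across a strip of holomorphy. -/
lemma integral_eq_integral_add_mul_I {H : ℂ → ℂ} {b : ℝ} (hb : 0 ≤ b)
    (hd : DifferentiableOn ℂ H {w | w.im ∈ Set.Icc 0 b}) {B : ℝ → ℝ}
    (hBtop : Filter.Tendsto B Filter.atTop (nhds 0))
    (hBbot : Filter.Tendsto B Filter.atBot (nhds 0))
    (hHtop : ∀ᶠ x : ℝ in Filter.atTop, ∀ y ∈ Set.Icc 0 b, ‖H (x + y * Complex.I)‖ ≤ B x)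
    (hHbot : ∀ᶠ x : ℝ in Filter.atBot, ∀ y ∈ Set.Icc 0 b, ‖H (x + y * Complex.I)‖ ≤ B x)
    (h0 : MeasureTheory.Integrable fun x : ℝ => H x)
    (h1 : MeasureTheory.Integrable fun x : ℝ => H (x + b * Complex.I)) :
    ∫ x : ℝ, H x = ∫ x : ℝ, H (x + b * Complex.I) := by
  have rect : ∀ T : ℝ, (∫ x in -T..T, H x) - (∫ x in -T..T, H (x + b * Complex.I)) =
      Complex.I • (∫ y in (0:ℝ)..b, H (((-T : ℝ) : ℂ) + y * Complex.I)) -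
      Complex.I • (∫ y in (0:ℝ)..b, H ((T : ℂ) + y * Complex.I)) := by
    intro T
    have := Complex.integral_boundary_rect_eq_zero_of_differentiableOn H ((-T : ℝ) : ℂ)
      (T + b * Complex.I) (hd.mono ?_)
    · simp only [Complex.ofReal_re, Complex.ofReal_im, Complex.add_re, Complex.mul_re,
        Complex.I_re, Complex.I_im, Complex.add_im, Complex.mul_im, mul_zero, mul_one, sub_zero,
        zero_mul, add_zero, zero_add, Complex.ofReal_zero] at this
      linear_combination this
    · intro w hw
      have := hw.2
      simpa [Set.uIcc_of_le hb] using this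
  have side : ∀ l : Filter ℝ, Filter.Tendsto B l (nhds 0) →
      (∀ᶠ x : ℝ in l, ∀ y ∈ Set.Icc 0 b, ‖H (x + y * Complex.I)‖ ≤ B x) →
      Filter.Tendsto (fun x : ℝ => Complex.I • ∫ y in (0:ℝ)..b, H ((x : ℂ) + y * Complex.I)) l
        (nhds 0) := by
    intro l hB hH
    refine squeeze_zero_norm' (a := fun x => B x * |b - 0|) ?_ (by simpa using hB.mul_const |b - 0|)
    filter_upwards [hH] with x hx
    rw [norm_smul, Complex.norm_I, one_mul]
    refine intervalIntegral.norm_integral_le_of_norm_le_const fun y hy => hx y ?_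
    rw [Set.uIoc_of_le hb] at hy
    exact ⟨hy.1.le, hy.2⟩
  have t1 := ((side _ hBbot hHbot).comp Filter.tendsto_neg_atTop_atBot).sub (side _ hBtop hHtop)
  have t2 := (MeasureTheory.intervalIntegral_tendsto_integral h0 Filter.tendsto_neg_atTop_atBot
    Filter.tendsto_id).sub (MeasureTheory.intervalIntegral_tendsto_integral h1
    Filter.tendsto_neg_atTop_atBot Filter.tendsto_id)
  have t3 := t2.congr rect
  have := tendsto_nhds_unique t3 t1
  rw [sub_zero] at this
  exact sub_eq_zero.1 this

/-- The integrand whose integral over the line is proportional to `exp (α ξ)`. -/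
noncomputable def logKernel (α ξ y : ℝ) : ℝ := Real.exp (α * y) / (1 + Real.exp (y - ξ))

lemma logKernel_pos (α ξ y : ℝ) : 0 < logKernel α ξ y := by unfold logKernel; positivity

lemma continuous_logKernel (α ξ : ℝ) : Continuous (logKernel α ξ) := by
  unfold logKernel
  exact Continuous.div (by fun_prop) (by fun_prop) fun y => by positivity

lemma logKernel_le_left (α ξ y : ℝ) : logKernel α ξ y ≤ Real.exp (α * y) :=
  div_le_self (Real.exp_pos _).le (by linarith [Real.exp_pos (y - ξ)])

lemma logKernel_le_right (α ξ y : ℝ) :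
    logKernel α ξ y ≤ Real.exp ξ * Real.exp (-((1 - α) * y)) := by
  rw [logKernel, div_le_iff₀ (by positivity), mul_add, ← Real.exp_add, ← Real.exp_add]
  have : ξ + -((1 - α) * y) + (y - ξ) = α * y := by ring
  rw [this]
  linarith [Real.exp_pos (ξ + -((1 - α) * y))]

lemma integrable_exp_neg_mul_abs {β : ℝ} (hβ : 0 < β) :
    MeasureTheory.Integrable fun y : ℝ => Real.exp (-(β * |y|)) := by
  rw [← MeasureTheory.integrableOn_univ, ← Set.Iic_union_Ioi (a := (0:ℝ))]
  refine MeasureTheory.IntegrableOn.union ?_ ?_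
  · refine (integrableOn_exp_mul_Iic hβ 0).congr_fun (fun y hy => ?_) measurableSet_Iic
    simp only [abs_of_nonpos (show y ≤ 0 from hy)]
    congr 1; ring
  · refine (integrableOn_exp_mul_Ioi (neg_lt_zero.2 hβ) 0).congr_fun (fun y hy => ?_)
      measurableSet_Ioi
    simp only [abs_of_pos (show 0 < y from hy)]
    congr 1; ring

lemma integral_exp_neg_mul_abs {β : ℝ} (hβ : 0 < β) :
    ∫ y : ℝ, Real.exp (-(β * |y|)) = 2 / β := by
  rw [integral_comp_abs (f := fun y => Real.exp (-(β * y)))]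
  have := integral_exp_mul_Ioi (neg_lt_zero.2 hβ) 0
  simp only [neg_mul, mul_zero, Real.exp_zero] at this
  rw [this]
  field_simp

lemma logKernel_le_abs {α : ℝ} (h0 : 0 < α) (h1 : α < 1) (ξ y : ℝ) :
    logKernel α ξ y ≤ max 1 (Real.exp ξ) * Real.exp (-(min α (1 - α) * |y|)) := by
  rcases le_total y 0 with hy | hy
  · rw [abs_of_nonpos hy]
    refine (logKernel_le_left α ξ y).trans ?_
    calc Real.exp (α * y) ≤ 1 * Real.exp (-(min α (1 - α) * -y)) := by
          rw [one_mul]; apply Real.exp_le_exp.2; nlinarith [min_le_left α (1 - α)]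
      _ ≤ _ := by gcongr; exact le_max_left _ _
  · rw [abs_of_nonneg hy]
    refine (logKernel_le_right α ξ y).trans ?_
    gcongr
    · exact le_max_right _ _
    · exact min_le_right _ _

lemma integrable_logKernel {α : ℝ} (h0 : 0 < α) (h1 : α < 1) (ξ : ℝ) :
    MeasureTheory.Integrable (logKernel α ξ) := by
  refine ((integrable_exp_neg_mul_abs (lt_min h0 (sub_pos.2 h1))).const_mul
    (max 1 (Real.exp ξ))).mono' (continuous_logKernel α ξ).aestronglyMeasurable
    (Filter.Eventually.of_forall fun y => ?_)
  rw [Real.norm_of_nonneg (logKernel_pos α ξ y).le]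
  exact logKernel_le_abs h0 h1 ξ y

lemma integral_logKernel (α ξ : ℝ) :
    ∫ y, logKernel α ξ y = Real.exp (α * ξ) * ∫ y, logKernel α 0 y := by
  rw [← MeasureTheory.integral_add_right_eq_self _ ξ, ← MeasureTheory.integral_const_mul]
  congr 1
  ext y
  simp only [logKernel]
  rw [add_sub_cancel_right, sub_zero, mul_add, Real.exp_add]
  ring

lemma integral_logKernel_pos {α : ℝ} (h0 : 0 < α) (h1 : α < 1) : 0 < ∫ y, logKernel α 0 y :=
  (MeasureTheory.integral_pos_iff_support_of_nonneg (fun y => (logKernel_pos α 0 y).le)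
    (integrable_logKernel h0 h1 0)).2 (by
      have : Function.support (logKernel α 0) = Set.univ :=
        Set.eq_univ_of_forall fun y => (logKernel_pos α 0 y).ne'
      simp [this])

/-- The oscillating factor `exp (2πiN U(w))` attached to the phase `U = nodePhaseC α`. -/
noncomputable def phaseExp (α : ℝ) (N : ℕ) (w : ℂ) : ℂ :=
  Complex.exp (2 * π * N * nodePhaseC α w * Complex.I)

lemma norm_phaseExp (α : ℝ) (N : ℕ) (w : ℂ) :
    ‖phaseExp α N w‖ = Real.exp (-(2 * π * N * (nodePhaseC α w).im)) := by
  have e : 2 * (π : ℂ) * N * nodePhaseC α w * Complex.I =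
      ((2 * π * N : ℝ) : ℂ) * nodePhaseC α w * Complex.I := by push_cast; ring
  rw [phaseExp, Complex.norm_exp, e, Complex.mul_I_re, Complex.im_ofReal_mul]

lemma norm_phaseExp_ofReal (α : ℝ) (N : ℕ) (y : ℝ) : ‖phaseExp α N y‖ = 1 := by
  rw [norm_phaseExp, nodePhaseC_ofReal, Complex.ofReal_im]
  simp

lemma norm_phaseExp_le {α : ℝ} (h0 : 0 < α) (h1 : α < 1) (N : ℕ) {w : ℂ} (hw0 : 0 ≤ w.im)
    (hw : w.im < 3 * π) : ‖phaseExp α N w‖ ≤ Real.exp (10 * π * N) := by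
  rw [norm_phaseExp, Real.exp_le_exp]
  have h := nodePhaseC_im_ge h0 h1 hw0 hw
  have h2 : 0 ≤ α / (4 * π ^ 2) * (2 * w.im * max w.re 0) := by positivity
  have h3 : -5 ≤ (nodePhaseC α w).im := by linarith
  have h4 : 0 ≤ 2 * π * N := by positivity
  nlinarith

lemma norm_phaseExp_le_of_im {α : ℝ} (h0 : 0 < α) (h1 : α < 1) {N : ℕ} (hN : 1 ≤ N) {w : ℂ}
    {r : ℝ} (hr : 1 ≤ r) (hr' : r < 3) (hw : w.im = r * π) :
    ‖phaseExp α N w‖ ≤ Real.exp (-(r * α * max w.re 0)) * Real.exp (-N) := by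
  have hpi := Real.pi_gt_three
  rw [norm_phaseExp, ← Real.exp_add, Real.exp_le_exp]
  have h := nodePhaseC_im_ge h0 h1 (w := w) (by rw [hw]; positivity) (by rw [hw]; nlinarith)
  have hm : 0 ≤ max w.re 0 := le_max_right _ _
  have h2 : r * α * max w.re 0 + 1 ≤ 2 * π * (nodePhaseC α w).im := by
    have e : 2 * π * (α / (4 * π ^ 2) * (2 * w.im * max w.re 0)) = r * α * max w.re 0 := by
      rw [hw]; field_simp; ring
    have : 25 ≤ -5 + 10 * w.im := by rw [hw]; nlinarith
    nlinarith
  have hN' : (1 : ℝ) ≤ N := by exact_mod_cast hN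
  have h3 : 0 ≤ r * α * max w.re 0 := by positivity
  nlinarith

lemma differentiableAt_phaseExp (α : ℝ) (N : ℕ) {w : ℂ} (hw : |w.im| < 3 * π) :
    DifferentiableAt ℂ (phaseExp α N) w := by
  have := differentiableAt_nodePhaseC α hw
  unfold phaseExp
  fun_prop

lemma continuous_phaseExp_line (α : ℝ) (N : ℕ) {b : ℝ} (hb : |b| < 3 * π) :
    Continuous fun x : ℝ => phaseExp α N (x + b * Complex.I) := by
  refine continuous_iff_continuousAt.2 fun x => ?_
  have h : ContinuousAt (phaseExp α N) (x + b * Complex.I) :=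
    (differentiableAt_phaseExp α N (by simpa using hb)).continuousAt
  exact h.comp (f := fun x : ℝ => (x : ℂ) + b * Complex.I) (by fun_prop)

lemma one_add_exp_eq_zero_iff {ξ : ℝ} {w : ℂ} (hw1 : -π < w.im) (hw2 : w.im < 3 * π) :
    1 + Complex.exp (w - ξ) = 0 ↔ w = ξ + π * Complex.I := by
  constructor
  · intro h
    have h2 : Complex.exp (w - ξ - π * Complex.I) = 1 := by
      rw [Complex.exp_sub, Complex.exp_pi_mul_I]
      linear_combination -h
    obtain ⟨n, hn⟩ := Complex.exp_eq_one_iff.1 h2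
    have him := congrArg Complex.im hn
    simp at him
    have hn0 : n = 0 := by
      have a1 : (n : ℝ) < 1 := by nlinarith [Real.pi_pos]
      have a2 : (-1 : ℝ) < n := by nlinarith [Real.pi_pos]
      have a1' : n < 1 := by exact_mod_cast a1
      have a2' : -1 < n := by exact_mod_cast a2
      omega
    rw [hn0] at hn
    linear_combination hn
  · rintro rfl
    rw [add_sub_cancel_left, Complex.exp_pi_mul_I]
    ring

lemma norm_one_add_exp_ge {ξ : ℝ} {w : ℂ} (hw : 1 ≤ |w.re - ξ|) :
    (1 + Real.exp (w.re - ξ)) / 3 ≤ ‖1 + Complex.exp (w - ξ)‖ := by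
  have hn : ‖Complex.exp (w - ξ)‖ = Real.exp (w.re - ξ) := by
    rw [Complex.norm_exp, Complex.sub_re, Complex.ofReal_re]
  have he : Real.exp 1 * Real.exp (-1) = 1 := by rw [← Real.exp_add]; simp
  have h2 : 2 ≤ Real.exp 1 := by linarith [Real.add_one_le_exp (1:ℝ)]
  rcases le_abs.1 hw with h | h
  · have h3 := norm_sub_norm_le (Complex.exp (w - ξ)) (-1)
    rw [sub_neg_eq_add, norm_neg, norm_one, hn, add_comm (Complex.exp _)] at h3
    have := Real.exp_le_exp.2 h
    linarith
  · have h3 := norm_sub_norm_le 1 (-Complex.exp (w - ξ))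
    rw [sub_neg_eq_add, norm_neg, norm_one, hn] at h3
    have := Real.exp_le_exp.2 (show w.re - ξ ≤ -1 by linarith)
    have : Real.exp (-1) ≤ 1 / 2 := by nlinarith [Real.exp_pos (-1)]
    linarith

lemma tendsto_logKernel_atTop {α : ℝ} (h1 : α < 1) (ξ : ℝ) :
    Filter.Tendsto (logKernel α ξ) Filter.atTop (nhds 0) := by
  refine squeeze_zero (fun y => (logKernel_pos α ξ y).le) (logKernel_le_right α ξ) ?_
  have := (Real.tendsto_exp_neg_atTop_nhds_zero.comp
    (Filter.tendsto_id.const_mul_atTop (sub_pos.2 h1))).const_mul (Real.exp ξ)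
  simpa using this

lemma tendsto_logKernel_atBot {α : ℝ} (h0 : 0 < α) (ξ : ℝ) :
    Filter.Tendsto (logKernel α ξ) Filter.atBot (nhds 0) :=
  squeeze_zero (fun y => (logKernel_pos α ξ y).le) (logKernel_le_left α ξ)
    (Real.tendsto_exp_atBot.comp (Filter.tendsto_id.const_mul_atBot h0))

lemma integrable_logKernel_mul {α : ℝ} (h0 : 0 < α) (h1 : α < 1) (ξ : ℝ) {u : ℝ → ℂ}
    (hu : Continuous u) {C : ℝ} (hC : ∀ x, ‖u x‖ ≤ C) :
    MeasureTheory.Integrable fun x : ℝ => (logKernel α ξ x : ℂ) * u x :=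
  (integrable_logKernel h0 h1 ξ).ofReal.mul_bdd (c := C) hu.aestronglyMeasurable
    (Filter.Eventually.of_forall hC)

/-- The identity obtained by moving the line of integration past the simple pole at `ξ + πi`. -/
lemma integral_logKernel_mul_phaseExp {α : ℝ} (h0 : 0 < α) (h1 : α < 1) (ξ : ℝ) (N : ℕ) :
    (∫ x : ℝ, (logKernel α ξ x : ℂ) * (phaseExp α N x - phaseExp α N (ξ + π * Complex.I))) =
      ∫ x : ℝ, Complex.exp (α * (2 * π * Complex.I)) * ((logKernel α ξ x : ℂ) *
        (phaseExp α N (x + (2 * π : ℝ) * Complex.I) - phaseExp α N (ξ + π * Complex.I))) := by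
  have hpi := Real.pi_pos
  set p : ℂ := ξ + π * Complex.I with hp
  have hpim : p.im = π := by simp [hp]
  let g : ℂ → ℂ := fun w => 1 + Complex.exp (w - ξ)
  let S : Set ℂ := {w | -π < w.im ∧ w.im < 3 * π}
  have hSo : IsOpen S :=
    (isOpen_lt continuous_const Complex.continuous_im).inter
      (isOpen_lt Complex.continuous_im continuous_const)
  have hpS : p ∈ S := ⟨by rw [hpim]; linarith, by rw [hpim]; linarith⟩
  have hSn : S ∈ nhds p := hSo.mem_nhds hpS
  have hgp : g p = 0 := (one_add_exp_eq_zero_iff hpS.1 hpS.2).2 hp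
  have hgd : Differentiable ℂ g := by fun_prop
  have hE : DifferentiableOn ℂ (phaseExp α N) S := fun w hw =>
    (differentiableAt_phaseExp α N
      (abs_lt.2 ⟨by linarith [hw.1], hw.2⟩)).differentiableWithinAt
  have hdE := (Complex.differentiableOn_dslope hSn).2 hE
  have hdg := (Complex.differentiableOn_dslope hSn).2 hgd.differentiableOn
  have hg0 : ∀ w ∈ S, dslope g p w ≠ 0 := by
    intro w hw
    rcases eq_or_ne w p with h | hne
    · have : HasDerivAt g (Complex.exp (p - ξ) * 1) p :=
        (((hasDerivAt_id p).sub_const (ξ : ℂ)).cexp).const_add 1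
      rw [h, dslope_same, this.deriv, mul_one]
      exact Complex.exp_ne_zero _
    · rw [dslope_of_ne _ hne, slope_def_field, hgp, sub_zero]
      exact div_ne_zero (fun h => hne ((one_add_exp_eq_zero_iff hw.1 hw.2).1 h))
        (sub_ne_zero.2 hne)
  let H : ℂ → ℂ := fun w =>
    Complex.exp (α * w) * (dslope (phaseExp α N) p w / dslope g p w)
  have hH : ∀ w, w ≠ p → H w =
      Complex.exp (α * w) * ((phaseExp α N w - phaseExp α N p) / g w) := by
    intro w hw
    simp only [H]
    rw [dslope_of_ne _ hw, dslope_of_ne _ hw, slope_def_field, slope_def_field, hgp, sub_zero,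
      div_div_div_cancel_right₀ (sub_ne_zero.2 hw)]
  have hHd : DifferentiableOn ℂ H {w | w.im ∈ Set.Icc 0 (2 * π)} := by
    refine DifferentiableOn.mono (t := S) ?_ fun w hw =>
      ⟨by linarith [hw.1], by linarith [hw.2]⟩
    exact (by fun_prop : Differentiable ℂ fun w : ℂ => Complex.exp (α * w)).differentiableOn.mul
      (hdE.div hdg hg0)
  have hbound : ∀ x : ℝ, 1 ≤ |x - ξ| → ∀ y ∈ Set.Icc 0 (2 * π),
      ‖H (x + y * Complex.I)‖ ≤ 6 * Real.exp (10 * π * N) * logKernel α ξ x := by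
    intro x hx y hy
    set w : ℂ := x + y * Complex.I with hw
    have hre : w.re = x := by simp [hw]
    have him : w.im = y := by simp [hw]
    have hwp : w ≠ p := by
      intro h
      have : w.re = ξ := by rw [h]; simp [hp]
      rw [hre] at this
      rw [this] at hx
      norm_num at hx
    have hg := norm_one_add_exp_ge (ξ := ξ) (w := w) (by rwa [hre])
    rw [hre] at hg
    rw [hH w hwp, norm_mul, norm_div, Complex.norm_exp, Complex.re_ofReal_mul, hre]
    have n1 := norm_phaseExp_le h0 h1 N (w := w) (by rw [him]; exact hy.1)
      (by rw [him]; linarith [hy.2])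
    have n2 := norm_phaseExp_le h0 h1 N (w := p) (by rw [hpim]; exact hpi.le)
      (by rw [hpim]; linarith)
    have n3 : ‖phaseExp α N w - phaseExp α N p‖ ≤ 2 * Real.exp (10 * π * N) :=
      (norm_sub_le _ _).trans (by linarith)
    calc Real.exp (α * x) * (‖phaseExp α N w - phaseExp α N p‖ / ‖g w‖)
        ≤ Real.exp (α * x) * (2 * Real.exp (10 * π * N) / ((1 + Real.exp (x - ξ)) / 3)) := by
          gcongr
      _ = _ := by rw [logKernel]; field_simp; ring
  have hreal : ∀ x : ℝ, H x =
      (logKernel α ξ x : ℂ) * (phaseExp α N x - phaseExp α N p) := by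
    intro x
    rw [hH x ?_]
    · simp only [g, logKernel]
      push_cast
      ring
    · intro h
      have := congrArg Complex.im h
      rw [hpim, Complex.ofReal_im] at this
      linarith
  have hshift : ∀ x : ℝ, H (x + (2 * π : ℝ) * Complex.I) =
      Complex.exp (α * (2 * π * Complex.I)) * ((logKernel α ξ x : ℂ) *
        (phaseExp α N (x + (2 * π : ℝ) * Complex.I) - phaseExp α N p)) := by
    intro x
    rw [hH _ ?_]
    · have e1 : g (x + (2 * π : ℝ) * Complex.I) = 1 + Complex.exp (x - ξ) := by
        simp only [g]
        rw [← Complex.exp_periodic (x - ξ)]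
        push_cast
        ring_nf
      have e2 : Complex.exp (α * (x + (2 * π : ℝ) * Complex.I)) =
          Complex.exp (α * (2 * π * Complex.I)) * Complex.exp (α * x) := by
        rw [← Complex.exp_add]
        push_cast
        ring_nf
      rw [e1, e2, logKernel]
      push_cast
      ring
    · intro h
      have := congrArg Complex.im h
      rw [hpim] at this
      simp at this
  have key := integral_eq_integral_add_mul_I (H := H) (b := 2 * π) (by positivity) hHd
    (B := fun x => 6 * Real.exp (10 * π * N) * logKernel α ξ x)
    (by simpa using (tendsto_logKernel_atTop h1 ξ).const_mul (6 * Real.exp (10 * π * N)))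
    (by simpa using (tendsto_logKernel_atBot h0 ξ).const_mul (6 * Real.exp (10 * π * N)))
    (by
      filter_upwards [Filter.eventually_ge_atTop (ξ + 1)] with x hx
      exact hbound x (le_abs.2 (Or.inl (by linarith))))
    (by
      filter_upwards [Filter.eventually_le_atBot (ξ - 1)] with x hx
      exact hbound x (le_abs.2 (Or.inr (by linarith))))
    (by
      simp only [hreal]
      refine integrable_logKernel_mul h0 h1 ξ (Continuous.sub ?_ continuous_const)
        (C := 1 + ‖phaseExp α N p‖) fun x => (norm_sub_le _ _).trans ?_
      · simpa using continuous_phaseExp_line α N (b := 0) (by simpa using hpi)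
      · rw [norm_phaseExp_ofReal])
    (by
      simp only [hshift]
      refine (integrable_logKernel_mul h0 h1 ξ (Continuous.sub (continuous_phaseExp_line α N ?_)
        continuous_const) (C := Real.exp (10 * π * N) + ‖phaseExp α N p‖) fun x =>
        (norm_sub_le _ _).trans ?_).const_mul _
      · rw [abs_of_pos (by positivity)]; linarith
      · gcongr
        exact norm_phaseExp_le h0 h1 N (by simp [hpi.le]) (by simp; linarith))
  simpa only [hreal, hshift] using key

lemma norm_integral_logKernel_mul_phaseExp_le {α : ℝ} (h0 : 0 < α) (h1 : α < 1) (ξ : ℝ) {N : ℕ}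
    (hN : 1 ≤ N) :
    ‖∫ x : ℝ, (logKernel α ξ x : ℂ) * phaseExp α N x‖ ≤
      (2 * (∫ y, logKernel α 0 y) + 2 / α) * Real.exp (-N) := by
  have hpi := Real.pi_pos
  have key := integral_logKernel_mul_phaseExp h0 h1 ξ N
  set p : ℂ := ξ + π * Complex.I with hp
  have hpim : p.im = 1 * π := by simp [hp]
  have hpre : p.re = ξ := by simp [hp]
  have hc0 : Continuous fun x : ℝ => phaseExp α N x := by
    simpa using continuous_phaseExp_line α N (b := 0) (by simpa using hpi)
  have hc1 := continuous_phaseExp_line α N (b := 2 * π)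
    (by rw [abs_of_pos (by positivity)]; linarith)
  have hb1 : ∀ x : ℝ, ‖phaseExp α N (x + (2 * π : ℝ) * Complex.I)‖ ≤
      Real.exp (-(2 * α * max x 0)) * Real.exp (-N) := by
    intro x
    have := norm_phaseExp_le_of_im h0 h1 hN (w := x + (2 * π : ℝ) * Complex.I) (r := 2)
      (by norm_num) (by norm_num) (by simp)
    simpa using this
  have hi0 := integrable_logKernel_mul h0 h1 ξ hc0 (C := 1) fun x => (norm_phaseExp_ofReal α N x).le
  have hi1 := integrable_logKernel_mul h0 h1 ξ hc1 (C := 1) fun x => (hb1 x).trans (by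
    rw [← Real.exp_add, Real.exp_le_one_iff]
    have : 0 ≤ 2 * α * max x 0 := by positivity
    have : (0 : ℝ) ≤ N := Nat.cast_nonneg N
    linarith)
  have hik : MeasureTheory.Integrable fun x : ℝ => (logKernel α ξ x : ℂ) :=
    (integrable_logKernel h0 h1 ξ).ofReal
  rw [MeasureTheory.integral_const_mul] at key
  simp only [mul_sub] at key
  rw [MeasureTheory.integral_sub hi0 (hik.mul_const _),
    MeasureTheory.integral_sub hi1 (hik.mul_const _), MeasureTheory.integral_mul_const,
    integral_complex_ofReal, integral_logKernel] at key
  set K := ∫ y, logKernel α 0 y with hK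
  have hK0 : 0 < K := integral_logKernel_pos h0 h1
  set e := Complex.exp (α * (2 * π * Complex.I)) with he
  have hen : ‖e‖ = 1 := by
    have : (α : ℂ) * (2 * π * Complex.I) = ((α * (2 * π) : ℝ) : ℂ) * Complex.I := by
      push_cast; ring
    rw [he, this, Complex.norm_exp_ofReal_mul_I]
  set J := ∫ x : ℝ, (logKernel α ξ x : ℂ) * phaseExp α N (x + (2 * π : ℝ) * Complex.I) with hJ
  set P : ℂ := ((Real.exp (α * ξ) * K : ℝ) : ℂ) * phaseExp α N p with hP
  have hPn : ‖P‖ ≤ K * Real.exp (-N) := by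
    have h2 := norm_phaseExp_le_of_im h0 h1 hN (w := p) le_rfl (by norm_num) hpim
    rw [hpre, one_mul] at h2
    rw [hP, norm_mul, Complex.norm_real, Real.norm_of_nonneg (by positivity)]
    have h3 : Real.exp (α * ξ) * Real.exp (-(α * max ξ 0)) ≤ 1 := by
      rw [← Real.exp_add, Real.exp_le_one_iff]
      nlinarith [le_max_left ξ 0]
    calc Real.exp (α * ξ) * K * ‖phaseExp α N p‖
        ≤ Real.exp (α * ξ) * K * (Real.exp (-(α * max ξ 0)) * Real.exp (-N)) := by gcongr
      _ = (Real.exp (α * ξ) * Real.exp (-(α * max ξ 0))) * (K * Real.exp (-N)) := by ring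
      _ ≤ 1 * (K * Real.exp (-N)) := by gcongr
      _ = _ := one_mul _
  have hJn : ‖J‖ ≤ 2 / α * Real.exp (-N) := by
    rw [← integral_exp_neg_mul_abs h0, ← MeasureTheory.integral_mul_const]
    refine MeasureTheory.norm_integral_le_of_norm_le
      ((integrable_exp_neg_mul_abs h0).mul_const _) (Filter.Eventually.of_forall fun x => ?_)
    rw [norm_mul, Complex.norm_real, Real.norm_of_nonneg (logKernel_pos _ _ _).le]
    calc logKernel α ξ x * ‖phaseExp α N (x + (2 * π : ℝ) * Complex.I)‖
        ≤ Real.exp (α * x) * (Real.exp (-(2 * α * max x 0)) * Real.exp (-N)) := by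
          gcongr
          · exact logKernel_le_left α ξ x
          · exact hb1 x
      _ = Real.exp (-(α * |x|)) * Real.exp (-N) := by
          rw [← mul_assoc, ← Real.exp_add]
          congr 2
          rcases le_total x 0 with hx | hx
          · rw [max_eq_right hx, abs_of_nonpos hx]; ring
          · rw [max_eq_left hx, abs_of_nonneg hx]; ring
  have key2 : (∫ x : ℝ, (logKernel α ξ x : ℂ) * phaseExp α N x) = P + e * J - e * P := by
    linear_combination key
  rw [key2]
  calc ‖P + e * J - e * P‖ ≤ ‖P‖ + ‖e * J‖ + ‖e * P‖ :=
        (norm_sub_le _ _).trans (by gcongr; exact norm_add_le _ _)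
    _ = 2 * ‖P‖ + ‖J‖ := by rw [norm_mul e J, norm_mul e P, hen]; ring
    _ ≤ _ := by linarith

/-- The inverse of `nodePhase α`: the (real-indexed) logarithmic nodes. -/
noncomputable def logNode (α : ℝ) : ℝ → ℝ := Function.invFun (nodePhase α)

lemma nodePhase_logNode {α : ℝ} (h0 : 0 < α) (u : ℝ) : nodePhase α (logNode α u) = u :=
  Function.rightInverse_invFun (surjective_nodePhase h0) u

lemma logNode_nodePhase {α : ℝ} (h0 : 0 < α) (h1 : α < 1) (y : ℝ) :
    logNode α (nodePhase α y) = y :=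
  Function.leftInverse_invFun (strictMono_nodePhase h0 h1).injective y

lemma continuous_logNode {α : ℝ} (h0 : 0 < α) (h1 : α < 1) : Continuous (logNode α) := by
  have h := (StrictMono.orderIsoOfSurjective _ (strictMono_nodePhase h0 h1)
    (surjective_nodePhase h0)).symm.continuous
  convert h using 1
  ext u
  apply (strictMono_nodePhase h0 h1).injective
  rw [nodePhase_logNode h0]
  exact ((StrictMono.orderIsoOfSurjective _ (strictMono_nodePhase h0 h1)
    (surjective_nodePhase h0)).apply_symm_apply u).symm

lemma logNode_le {α : ℝ} (h0 : 0 < α) (u : ℝ) : logNode α u ≤ u / 10 := by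
  have := le_nodePhase h0 (logNode α u)
  rw [nodePhase_logNode h0] at this
  linarith

lemma nodePhase_zero (α : ℝ) : nodePhase α 0 = 0 := by simp [nodePhase]

lemma logNode_nonneg {α : ℝ} (h0 : 0 < α) (h1 : α < 1) {u : ℝ} (hu : 0 ≤ u) :
    0 ≤ logNode α u := by
  rw [← (strictMono_nodePhase h0 h1).le_iff_le, nodePhase_zero, nodePhase_logNode h0]
  exact hu

lemma exp_neg_mul_abs_logNode_le {α β : ℝ} (h0 : 0 < α) (h1 : α < 1) (hβ : 0 < β) (u : ℝ) :
    Real.exp (-(β * |logNode α u|)) ≤ 2400 * Real.exp β / β ^ 4 / (1 + |u|) ^ 2 := by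
  set y := logNode α u with hy
  have hu : |u| ≤ y ^ 2 + 10 * |y| := by
    have e := nodePhase_logNode h0 u
    have a1 := nodePhase_le h0 y
    have a2 := le_nodePhase h0 y
    have hc := coeff_le h1
    rw [e] at a1 a2
    rw [abs_le]
    constructor
    · nlinarith [neg_abs_le y, sq_nonneg y]
    · nlinarith [le_abs_self y, sq_nonneg y]
  have hexp := Real.pow_div_factorial_le_exp (x := β * (1 + |y|)) (by positivity) 4
  have h4 : (Nat.factorial 4 : ℝ) = 24 := by norm_num [Nat.factorial]
  rw [h4, mul_add, mul_one, Real.exp_add, div_le_iff₀ (by norm_num)] at hexp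
  have hb : (1 + |u|) ^ 2 ≤ 100 * (1 + |y|) ^ 4 := by
    have : 1 + |u| ≤ 10 * (1 + |y|) ^ 2 := by nlinarith [abs_nonneg y, sq_abs y]
    calc (1 + |u|) ^ 2 ≤ (10 * (1 + |y|) ^ 2) ^ 2 := by gcongr
      _ = _ := by ring
  rw [Real.exp_neg, div_div, le_div_iff₀ (by positivity), ← div_eq_inv_mul,
    div_le_iff₀ (Real.exp_pos _)]
  have e : (β + β * |y|) ^ 4 = β ^ 4 * (1 + |y|) ^ 4 := by ring
  rw [e] at hexp
  calc β ^ 4 * (1 + |u|) ^ 2 ≤ β ^ 4 * (100 * (1 + |y|) ^ 4) := by gcongr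
    _ ≤ _ := by linarith

/-- The terms of the nonuniform trapezoidal rule for `∫ y, logKernel α ξ y`. -/
noncomputable def nodeTerm (α ξ u : ℝ) : ℝ :=
  logKernel α ξ (logNode α u) / nodeDensity α (logNode α u)

lemma nodeTerm_nonneg {α : ℝ} (h0 : 0 < α) (h1 : α < 1) (ξ u : ℝ) : 0 ≤ nodeTerm α ξ u :=
  div_nonneg (logKernel_pos _ _ _).le (zero_le_one.trans (one_le_nodeDensity h0 h1 _))

lemma nodeTerm_le {α : ℝ} (h0 : 0 < α) (h1 : α < 1) (ξ u : ℝ) :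
    nodeTerm α ξ u ≤ logKernel α ξ (logNode α u) :=
  div_le_self (logKernel_pos _ _ _).le (one_le_nodeDensity h0 h1 _)

lemma continuous_nodeTerm {α : ℝ} (h0 : 0 < α) (h1 : α < 1) (ξ : ℝ) :
    Continuous (nodeTerm α ξ) :=
  ((continuous_logKernel α ξ).comp (continuous_logNode h0 h1)).div
    ((continuous_nodeDensity α).comp (continuous_logNode h0 h1))
    fun _ => (one_pos.trans_le (one_le_nodeDensity h0 h1 _)).ne'

lemma isBigO_nodeTerm {α : ℝ} (h0 : 0 < α) (h1 : α < 1) (ξ : ℝ) :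
    (fun u : ℝ => (nodeTerm α ξ u : ℂ)) =O[Filter.cocompact ℝ] fun u : ℝ => |u| ^ (-2 : ℝ) := by
  have hβ : 0 < min α (1 - α) := lt_min h0 (sub_pos.2 h1)
  refine Asymptotics.IsBigO.of_bound
    (max 1 (Real.exp ξ) * (2400 * Real.exp (min α (1 - α)) / min α (1 - α) ^ 4)) ?_
  filter_upwards [(isCompact_singleton (x := (0 : ℝ))).compl_mem_cocompact] with u hu
  have hu0 : 0 < |u| := abs_pos.2 hu
  rw [Complex.norm_real, Real.norm_of_nonneg (nodeTerm_nonneg h0 h1 ξ u),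
    Real.norm_of_nonneg (by positivity), Real.rpow_neg hu0.le, ← div_eq_mul_inv]
  refine ((nodeTerm_le h0 h1 ξ u).trans (logKernel_le_abs h0 h1 ξ _)).trans ?_
  rw [mul_div_assoc]
  gcongr
  refine (exp_neg_mul_abs_logNode_le h0 h1 hβ u).trans ?_
  rw [Real.rpow_two]
  gcongr
  linarith

lemma summable_nodeTerm {α : ℝ} (h0 : 0 < α) (h1 : α < 1) (ξ : ℝ) :
    Summable fun j : ℤ => nodeTerm α ξ j := by
  have := summable_of_isBigO (Real.summable_abs_int_rpow (b := 2) (by norm_num))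
    ((isBigO_nodeTerm h0 h1 ξ).norm_left.comp_tendsto Int.tendsto_coe_cofinite)
  refine this.congr fun j => ?_
  simp [abs_of_nonneg (nodeTerm_nonneg h0 h1 ξ j)]

open scoped FourierTransform in
lemma fourier_nodeTerm {α : ℝ} (h0 : 0 < α) (h1 : α < 1) (ξ w : ℝ) :
    𝓕 (fun u : ℝ => (nodeTerm α ξ u : ℂ)) w =
      ∫ y : ℝ, (logKernel α ξ y : ℂ) *
        Complex.exp (((-(2 * π * w * nodePhase α y) : ℝ) : ℂ) * Complex.I) := by
  rw [Real.fourier_real_eq_integral_exp_smul]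
  have := MeasureTheory.integral_image_eq_integral_abs_deriv_smul (s := Set.univ)
    MeasurableSet.univ (fun y _ => (hasDerivAt_nodePhase α y).hasDerivWithinAt)
    (strictMono_nodePhase h0 h1).injective.injOn
    (fun v : ℝ => Complex.exp (((-2 * π * v * w : ℝ) : ℂ) * Complex.I) •
      (nodeTerm α ξ v : ℂ))
  rw [Set.image_univ, (surjective_nodePhase h0).range_eq] at this
  simp only [MeasureTheory.Measure.restrict_univ] at this
  rw [this]
  congr 1
  ext y
  have hd := one_pos.trans_le (one_le_nodeDensity h0 h1 y)
  have hd' : (nodeDensity α y : ℂ) ≠ 0 := by exact_mod_cast hd.ne'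
  rw [nodeTerm, logNode_nodePhase h0 h1, abs_of_pos hd, smul_eq_mul, Complex.real_smul]
  have e : -2 * π * nodePhase α y * w = -(2 * π * w * nodePhase α y) := by ring
  rw [e, Complex.ofReal_div]
  field_simp

open scoped FourierTransform in
lemma norm_fourier_nodeTerm_le {α : ℝ} (h0 : 0 < α) (h1 : α < 1) (ξ : ℝ) {n : ℤ} (hn : n ≠ 0) :
    ‖𝓕 (fun u : ℝ => (nodeTerm α ξ u : ℂ)) n‖ ≤
      (2 * (∫ y, logKernel α 0 y) + 2 / α) * Real.exp (-|(n : ℝ)|) := by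
  have hN : 1 ≤ n.natAbs := Int.natAbs_pos.2 hn
  have key := norm_integral_logKernel_mul_phaseExp_le h0 h1 ξ hN
  have hcast : (n.natAbs : ℝ) = |(n : ℝ)| := by
    rw [← Int.cast_abs, Int.abs_eq_natAbs]; simp
  rw [← hcast]
  refine le_of_eq_of_le ?_ key
  have hph : ∀ y : ℝ, phaseExp α n.natAbs y =
      Complex.exp (((2 * π * n.natAbs * nodePhase α y : ℝ) : ℂ) * Complex.I) := by
    intro y
    rw [phaseExp, nodePhaseC_ofReal]
    push_cast
    rfl
  rw [fourier_nodeTerm h0 h1]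
  simp only [hph]
  rcases Int.natAbs_eq n with h | h
  · have hr : (n : ℝ) = n.natAbs := by
      conv_lhs => rw [h]
      simp
    rw [hr, ← RCLike.norm_conj, ← integral_conj]
    congr 2
    ext y
    rw [map_mul, Complex.conj_ofReal, ← Complex.exp_conj, map_mul, Complex.conj_ofReal,
      Complex.conj_I, Complex.ofReal_neg]
    ring_nf
  · have hr : (n : ℝ) = -n.natAbs := by
      conv_lhs => rw [h]
      simp
    rw [hr]
    congr 2
    ext y
    ring_nf

lemma summable_exp_neg_abs_int : Summable fun n : ℤ => Real.exp (-|(n : ℝ)|) := by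
  refine Summable.of_nat_of_neg ?_ ?_ <;>
  · simp only [Int.cast_neg, Int.cast_natCast, abs_neg, Nat.abs_cast]
    exact Real.summable_exp_neg_nat

open scoped FourierTransform in
/-- The trapezoidal rule with the graded nodes is uniformly accurate. -/
lemma abs_tsum_int_nodeTerm_sub_le {α : ℝ} (h0 : 0 < α) (h1 : α < 1) (ξ : ℝ) :
    |(∑' j : ℤ, nodeTerm α ξ j) - Real.exp (α * ξ) * ∫ y, logKernel α 0 y| ≤
      (2 * (∫ y, logKernel α 0 y) + 2 / α) * ∑' n : ℤ, Real.exp (-|(n : ℝ)|) := by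
  set A := 2 * (∫ y, logKernel α 0 y) + 2 / α with hA
  set G : ℝ → ℂ := fun u => (nodeTerm α ξ u : ℂ) with hG
  have hb := fun (n : ℤ) (hn : n ≠ 0) => norm_fourier_nodeTerm_le h0 h1 ξ hn
  have hsum : Summable fun n : ℤ => A * Real.exp (-|(n : ℝ)|) :=
    summable_exp_neg_abs_int.mul_left A
  have hFs : Summable fun n : ℤ => 𝓕 G n := by
    refine hsum.of_norm_bounded_eventually ?_
    filter_upwards [(Set.finite_singleton (0 : ℤ)).compl_mem_cofinite] with n hn
    exact hb n hn
  have hP := Real.tsum_eq_tsum_fourier_of_rpow_decay_of_summable (f := G)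
    (Complex.continuous_ofReal.comp (continuous_nodeTerm h0 h1 ξ)) (b := 2) (by norm_num)
    (isBigO_nodeTerm h0 h1 ξ) hFs 0
  have hzero : 𝓕 G ((0 : ℤ) : ℝ) = ((Real.exp (α * ξ) * ∫ y, logKernel α 0 y : ℝ) : ℂ) := by
    rw [hG, fourier_nodeTerm h0 h1, ← integral_logKernel, ← integral_complex_ofReal]
    simp
  have h3 : (∑' n : ℤ, 𝓕 G n * fourier n ((0 : ℝ) : UnitAddCircle)) = ∑' n : ℤ, 𝓕 G n := by
    simp
  rw [h3, hFs.tsum_eq_add_tsum_ite 0, hzero] at hP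
  have h4 : ((∑' j : ℤ, nodeTerm α ξ j : ℝ) : ℂ) = ∑' j : ℤ, G (0 + j) := by
    rw [Complex.ofReal_tsum]
    simp [hG]
  rw [← Real.norm_eq_abs, ← Complex.norm_real, Complex.ofReal_sub, h4, hP, add_sub_cancel_left,
    ← tsum_mul_left]
  refine tsum_of_norm_bounded hsum.hasSum fun n => ?_
  by_cases hn : n = 0
  · rw [if_pos hn, norm_zero]
    have := integral_logKernel_pos h0 h1
    positivity
  · rw [if_neg hn]
    exact hb n hn

lemma abs_tsum_nat_nodeTerm_sub_le {α : ℝ} (h0 : 0 < α) (h1 : α < 1) :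
    ∃ A : ℝ, 0 < A ∧ ∀ ξ : ℝ, Summable (fun j : ℕ => nodeTerm α ξ j) ∧
      |(∑' j : ℕ, nodeTerm α ξ j) - Real.exp (α * ξ) * ∫ y, logKernel α 0 y| ≤ A := by
  have hneg : Summable fun j : ℕ => Real.exp (-(j * (α / 10))) := by
    have := Real.summable_exp_nat_mul_iff.2 (neg_lt_zero.2 (div_pos h0 (by norm_num : (0:ℝ) < 10)))
    simpa only [mul_neg] using this
  have hK := integral_logKernel_pos h0 h1
  refine ⟨(2 * (∫ y, logKernel α 0 y) + 2 / α) * ∑' n : ℤ, Real.exp (-|(n : ℝ)|) +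
    ∑' j : ℕ, Real.exp (-(j * (α / 10))), ?_, fun ξ => ?_⟩
  · have s1 : 0 < ∑' n : ℤ, Real.exp (-|(n : ℝ)|) :=
      summable_exp_neg_abs_int.tsum_pos (fun _ => (Real.exp_pos _).le) 0 (Real.exp_pos _)
    have s2 : 0 ≤ ∑' j : ℕ, Real.exp (-(j * (α / 10))) := tsum_nonneg fun _ => (Real.exp_pos _).le
    positivity
  have hs := summable_nodeTerm h0 h1 ξ
  have hs1 : Summable fun j : ℕ => nodeTerm α ξ j := by
    exact (hs.comp_injective (Nat.cast_injective (R := ℤ))).congr fun j => by simp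
  have hinj : Function.Injective fun j : ℕ => (-(j + 1) : ℤ) := fun a b h => by
    simp only at h
    omega
  have hs2 : Summable fun j : ℕ => nodeTerm α ξ ((-(j + 1) : ℤ) : ℝ) :=
    hs.comp_injective hinj
  refine ⟨hs1, ?_⟩
  have hsplit : (∑' j : ℤ, nodeTerm α ξ j) = (∑' j : ℕ, nodeTerm α ξ j) +
      ∑' j : ℕ, nodeTerm α ξ ((-(j + 1) : ℤ) : ℝ) := by
    have := tsum_of_nat_of_neg_add_one (f := fun j : ℤ => nodeTerm α ξ j) (by simpa using hs1) hs2
    simpa using this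
  have hleft : (∑' j : ℕ, nodeTerm α ξ ((-(j + 1) : ℤ) : ℝ)) ≤
      ∑' j : ℕ, Real.exp (-(j * (α / 10))) := by
    refine hs2.tsum_le_tsum (fun j => ?_) hneg
    refine ((nodeTerm_le h0 h1 ξ _).trans (logKernel_le_left α ξ _)).trans
      (Real.exp_le_exp.2 ?_)
    have := logNode_le h0 ((-(j + 1) : ℤ) : ℝ)
    push_cast at this ⊢
    nlinarith
  have hleft0 : 0 ≤ ∑' j : ℕ, nodeTerm α ξ ((-(j + 1) : ℤ) : ℝ) :=
    tsum_nonneg fun j => nodeTerm_nonneg h0 h1 ξ _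
  have key := abs_tsum_int_nodeTerm_sub_le h0 h1 ξ
  rw [hsplit] at key
  rw [abs_le] at key ⊢
  constructor <;> linarith [key.1, key.2]

/-- A pointwise error bound for one admissible rational function bounds `buraError`. -/
lemma buraError_zero_le {α e : ℝ} {k : ℕ} {P Q : Polynomial ℝ} (hP : P.natDegree ≤ k)
    (hQ : Q.natDegree ≤ k) (hQ0 : ∀ z ∈ Set.Icc (0:ℝ) 1, Q.eval z ≠ 0)
    (h : ∀ z ∈ Set.Icc (0:ℝ) 1, |P.eval z / Q.eval z - z ^ α| ≤ e) : buraError 0 α k ≤ e := by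
  have hmem : (⨆ z : Set.Icc (0:ℝ) 1,
      |P.eval (z : ℝ) / Q.eval (z : ℝ) - (z : ℝ) ^ α / (1 + 0 * (z : ℝ) ^ α)|) ≤ e := by
    have : Nonempty (Set.Icc (0:ℝ) 1) := ⟨⟨0, by simp⟩⟩
    refine ciSup_le fun z => ?_
    simpa using h z z.2
  rw [buraError]
  refine le_trans (csInf_le ?_ ?_) hmem
  · refine ⟨0, ?_⟩
    rintro _ ⟨P, Q, -, -, -, rfl⟩
    exact Real.iSup_nonneg fun _ => abs_nonneg _
  · exact ⟨P, Q, hP, hQ, hQ0, rfl⟩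

lemma exists_polynomial_eq_sum_simple_fractions (w t : ℕ → ℝ) (ht : ∀ j, 0 < t j) (n : ℕ) :
    ∃ P Q : Polynomial ℝ, P.natDegree ≤ n ∧ Q.natDegree ≤ n ∧
      (∀ z ∈ Set.Icc (0:ℝ) 1, Q.eval z ≠ 0) ∧
      ∀ z ∈ Set.Icc (0:ℝ) 1,
        P.eval z / Q.eval z = ∑ j ∈ Finset.range n, w j * (z / (z + t j)) := by
  induction n with
  | zero => exact ⟨0, 1, by simp, by simp, by simp, by simp⟩
  | succ n ih =>
    obtain ⟨P, Q, hP, hQ, hQ0, h⟩ := ih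
    refine ⟨P * (Polynomial.X + Polynomial.C (t n)) + Polynomial.C (w n) * Polynomial.X * Q,
      Q * (Polynomial.X + Polynomial.C (t n)), ?_, ?_, ?_, ?_⟩
    · refine Polynomial.natDegree_add_le_of_degree_le
        (Polynomial.natDegree_mul_le_of_le hP (Polynomial.natDegree_X_add_C _).le) ?_
      rw [add_comm n 1]
      exact Polynomial.natDegree_mul_le_of_le
        ((Polynomial.natDegree_C_mul_le _ _).trans Polynomial.natDegree_X_le) hQ
    · exact Polynomial.natDegree_mul_le_of_le hQ (Polynomial.natDegree_X_add_C _).le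
    · intro z hz
      have : z + t n ≠ 0 := by linarith [hz.1, ht n] |> ne_of_gt
      simpa using ⟨hQ0 z hz, this⟩
    · intro z hz
      have h1 : z + t n ≠ 0 := (add_pos_of_nonneg_of_pos hz.1 (ht n)).ne'
      have h2 := hQ0 z hz
      rw [Finset.sum_range_succ, ← h z hz]
      simp only [Polynomial.eval_add, Polynomial.eval_mul, Polynomial.eval_X, Polynomial.eval_C]
      field_simp

/-- The truncated Taylor expansion of `1 / (z + t)` about `z = 1/2`. -/
lemma abs_inv_add_sub_sum_le {t z : ℝ} (ht : 1 ≤ t) (hz : z ∈ Set.Icc (0:ℝ) 1) (D : ℕ) :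
    |1 / (z + t) - ∑ i ∈ Finset.range D, (1 / 2 - z) ^ i / (t + 1 / 2) ^ (i + 1)| ≤
      (1 / 3) ^ D / t := by
  have h1 : 0 < z + t := by linarith [hz.1]
  have h2 : 0 < t + 1 / 2 := by linarith
  have e : 1 / (z + t) - ∑ i ∈ Finset.range D, (1 / 2 - z) ^ i / (t + 1 / 2) ^ (i + 1) =
      ((1 / 2 - z) / (t + 1 / 2)) ^ D / (z + t) := by
    induction D with
    | zero => simp
    | succ D ih =>
      rw [Finset.sum_range_succ, ← sub_sub, ih, div_pow, div_pow]
      field_simp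
      ring
  rw [e, abs_div, abs_pow, abs_of_pos h1]
  have h3 : |(1 / 2 - z) / (t + 1 / 2)| ≤ 1 / 3 := by
    rw [abs_div, abs_of_pos h2, div_le_iff₀ h2, abs_le]
    constructor <;> linarith [hz.1, hz.2]
  have h4 : t ≤ z + t := by linarith [hz.1]
  gcongr

/-- An infinite sum of simple fractions with poles in `(-∞, -1]` is approximated on `[0,1]` by
polynomials at a geometric rate. -/
lemma exists_polynomial_approx_tsum (w t : ℕ → ℝ) (hw : ∀ j, 0 ≤ w j) (ht : ∀ j, 1 ≤ t j)
    (hs : Summable fun j => w j / t j) (D : ℕ) :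
    ∃ p : Polynomial ℝ, p.natDegree ≤ D ∧ ∀ z ∈ Set.Icc (0:ℝ) 1,
      |(∑' j, w j * (z / (z + t j))) - p.eval z| ≤ (1 / 3) ^ D * ∑' j, w j / t j := by
  have ht0 : ∀ j, 0 < t j := fun j => one_pos.trans_le (ht j)
  have hsi : ∀ i, Summable fun j => w j / (t j + 1 / 2) ^ (i + 1) := by
    intro i
    refine hs.of_nonneg_of_le (fun j => div_nonneg (hw j) (by have := ht0 j; positivity))
      fun j => div_le_div_of_nonneg_left (hw j) (ht0 j) ?_
    calc t j ≤ t j + 1 / 2 := by linarith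
      _ ≤ _ := le_self_pow₀ (by linarith [ht j]) (Nat.succ_ne_zero i)
  let a : ℕ → ℝ := fun i => ∑' j, w j / (t j + 1 / 2) ^ (i + 1)
  refine ⟨Polynomial.X * ∑ i ∈ Finset.range D,
    Polynomial.C (a i) * (Polynomial.C (1 / 2) - Polynomial.X) ^ i, ?_, fun z hz => ?_⟩
  · rcases Nat.eq_zero_or_pos D with rfl | hD
    · simp
    have hsum : (∑ i ∈ Finset.range D,
        Polynomial.C (a i) * (Polynomial.C (1 / 2) - Polynomial.X) ^ i).natDegree ≤ D - 1 := by
      refine Polynomial.natDegree_sum_le_of_forall_le _ _ fun i hi => ?_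
      refine (Polynomial.natDegree_C_mul_le _ _).trans ?_
      have h1 : (Polynomial.C (1 / 2 : ℝ) - Polynomial.X).natDegree ≤ 1 :=
        Polynomial.natDegree_sub_le_of_le ((Polynomial.natDegree_C _).trans_le zero_le_one)
          Polynomial.natDegree_X_le
      refine (Polynomial.natDegree_pow_le_of_le i h1).trans ?_
      have := Finset.mem_range.1 hi
      omega
    refine (Polynomial.natDegree_mul_le_of_le Polynomial.natDegree_X_le hsum).trans ?_
    omega
  have hsz : Summable fun j => w j * (z / (z + t j)) := by
    refine hs.of_nonneg_of_le (fun j => mul_nonneg (hw j) (div_nonneg hz.1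
      (by linarith [hz.1, ht0 j]))) fun j => ?_
    rw [div_eq_mul_one_div (w j)]
    refine mul_le_mul_of_nonneg_left ?_ (hw j)
    exact div_le_div₀ zero_le_one hz.2 (ht0 j) (by linarith [hz.1])
  have heval : (Polynomial.X * ∑ i ∈ Finset.range D,
      Polynomial.C (a i) * (Polynomial.C (1 / 2) - Polynomial.X) ^ i).eval z =
      ∑' j, z * ∑ i ∈ Finset.range D, (1 / 2 - z) ^ i * (w j / (t j + 1 / 2) ^ (i + 1)) := by
    rw [tsum_mul_left, Summable.tsum_finsetSum fun i _ => (hsi i).mul_left _]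
    simp only [Polynomial.eval_mul, Polynomial.eval_X, Polynomial.eval_finsetSum,
      Polynomial.eval_C, Polynomial.eval_pow, Polynomial.eval_sub, tsum_mul_left, a]
    simp only [mul_comm]
  have hsp : Summable fun j => z * ∑ i ∈ Finset.range D,
      (1 / 2 - z) ^ i * (w j / (t j + 1 / 2) ^ (i + 1)) :=
    (summable_sum fun i _ => (hsi i).mul_left _).mul_left z
  rw [heval, ← hsz.tsum_sub hsp, ← tsum_mul_left, ← Real.norm_eq_abs]
  refine tsum_of_norm_bounded (hs.mul_left _).hasSum fun j => ?_
  have e : w j * (z / (z + t j)) - z * ∑ i ∈ Finset.range D,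
      (1 / 2 - z) ^ i * (w j / (t j + 1 / 2) ^ (i + 1)) =
      w j * (z * (1 / (z + t j) -
        ∑ i ∈ Finset.range D, (1 / 2 - z) ^ i / (t j + 1 / 2) ^ (i + 1))) := by
    rw [mul_sub, mul_sub, mul_one_div, Finset.mul_sum, Finset.mul_sum, Finset.mul_sum]
    congr 1
    refine Finset.sum_congr rfl fun i _ => ?_
    ring
  rw [e, Real.norm_eq_abs, abs_mul, abs_mul, abs_of_nonneg (hw j), abs_of_nonneg hz.1]
  calc w j * (z * _) ≤ w j * (1 * ((1 / 3) ^ D / t j)) := by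
        refine mul_le_mul_of_nonneg_left ?_ (hw j)
        exact mul_le_mul hz.2 (abs_inv_add_sub_sum_le (ht j) hz D) (abs_nonneg _) zero_le_one
    _ = _ := by ring

lemma summable_exp_neg_mul_abs_logNode {α β : ℝ} (h0 : 0 < α) (h1 : α < 1) (hβ : 0 < β) :
    Summable fun j : ℕ => Real.exp (-(β * |logNode α j|)) := by
  have h2 : Summable fun j : ℕ => 2400 * Real.exp β / β ^ 4 * (1 / ((j + 1 : ℕ) : ℝ) ^ 2) :=
    ((summable_nat_add_iff 1).2 (Real.summable_one_div_nat_pow.2 one_lt_two)).mul_left _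
  refine h2.of_nonneg_of_le (fun j => (Real.exp_pos _).le) fun j => ?_
  refine (exp_neg_mul_abs_logNode_le h0 h1 hβ j).trans (le_of_eq ?_)
  rw [Nat.abs_cast]
  push_cast
  ring

/-- Rational approximation with accuracy of order `exp (-α M)` from degree
`α M² / (4π²) + O(M)`. -/
lemma exists_buraError_le_exp {α : ℝ} (h0 : 0 < α) (h1 : α < 1) :
    ∃ B : ℝ, 0 < B ∧ ∀ M : ℝ, 0 ≤ M → ∀ k : ℕ,
      α / (4 * π ^ 2) * M ^ 2 + 11 * M + 2 ≤ k → buraError 0 α k ≤ B * Real.exp (-(α * M)) := by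
  obtain ⟨A, hA, hquad⟩ := abs_tsum_nat_nodeTerm_sub_le h0 h1
  have hK := integral_logKernel_pos h0 h1
  set K := ∫ y, logKernel α 0 y
  have hS := summable_exp_neg_mul_abs_logNode h0 h1 (sub_pos.2 h1)
  set S := ∑' j : ℕ, Real.exp (-((1 - α) * |logNode α j|)) with hSdef
  have hS0 : 0 ≤ S := tsum_nonneg fun j => (Real.exp_pos _).le
  refine ⟨(A + S) / K, by positivity, fun M hM k hk => ?_⟩
  set n := ⌈nodePhase α M⌉₊ with hn
  set D := ⌈M⌉₊ with hD
  have hnD : n + D ≤ k := by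
    have a1 : (n : ℝ) < nodePhase α M + 1 :=
      Nat.ceil_lt_add_one (by linarith [le_nodePhase h0 M])
    have a2 : (D : ℝ) < M + 1 := Nat.ceil_lt_add_one hM
    have a3 := nodePhase_le h0 M
    have : ((n + D : ℕ) : ℝ) ≤ k := by push_cast; linarith
    exact_mod_cast this
  let w : ℕ → ℝ := fun j => Real.exp (α * logNode α j) / nodeDensity α (logNode α j)
  let t : ℕ → ℝ := fun j => Real.exp (logNode α j - M)
  have hdens : ∀ j : ℕ, 1 ≤ nodeDensity α (logNode α j) := fun j => one_le_nodeDensity h0 h1 _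
  have hw : ∀ j, 0 ≤ w j := fun j => div_nonneg (Real.exp_pos _).le (by linarith [hdens j])
  have ht : ∀ j, 0 < t j := fun j => Real.exp_pos _
  have ht1 : ∀ j, 1 ≤ t (j + n) := by
    intro j
    rw [Real.one_le_exp_iff, sub_nonneg, ← (strictMono_nodePhase h0 h1).le_iff_le,
      nodePhase_logNode h0]
    refine (Nat.le_ceil _).trans ?_
    push_cast
    linarith [(Nat.cast_nonneg j : (0 : ℝ) ≤ j)]
  have hwt : ∀ j, w j / t j ≤ Real.exp M * Real.exp (-((1 - α) * |logNode α j|)) := by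
    intro j
    rw [abs_of_nonneg (logNode_nonneg h0 h1 (Nat.cast_nonneg j)), ← Real.exp_add]
    have : w j ≤ Real.exp (α * logNode α j) := div_le_self (Real.exp_pos _).le (hdens j)
    rw [div_le_iff₀ (ht j), ← Real.exp_add]
    refine this.trans (Real.exp_le_exp.2 (le_of_eq ?_))
    ring
  have hwts : Summable fun j => w j / t j :=
    (hS.mul_left (Real.exp M)).of_nonneg_of_le (fun j => div_nonneg (hw j) (ht j).le) hwt
  have htail : ∑' j, w (j + n) / t (j + n) ≤ Real.exp M * S := by
    rw [hSdef, ← tsum_mul_left]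
    refine le_trans ?_ (hwts.tsum_le_tsum hwt (hS.mul_left _))
    rw [← hwts.sum_add_tsum_nat_add n]
    have := Finset.sum_nonneg fun j (_ : j ∈ Finset.range n) => div_nonneg (hw j) (ht j).le
    linarith
  obtain ⟨P, Q, hP, hQ, hQ0, hPQ⟩ := exists_polynomial_eq_sum_simple_fractions w t ht n
  obtain ⟨p, hp, hpz⟩ := exists_polynomial_approx_tsum (fun j => w (j + n)) (fun j => t (j + n))
    (fun j => hw _) ht1 ((summable_nat_add_iff n).2 hwts) D
  set c := Real.exp (-(α * M)) / K with hc
  have hc0 : 0 < c := by positivity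
  refine buraError_zero_le (P := Polynomial.C c * (P + p * Q)) (Q := Q) ?_ (by omega) hQ0 ?_
  · refine (Polynomial.natDegree_C_mul_le _ _).trans
      (Polynomial.natDegree_add_le_of_degree_le (by omega) ?_)
    refine (Polynomial.natDegree_mul_le_of_le hp hQ).trans ?_
    omega
  intro z hz
  have heval : (Polynomial.C c * (P + p * Q)).eval z / Q.eval z =
      c * ((∑ j ∈ Finset.range n, w j * (z / (z + t j))) + p.eval z) := by
    have := hQ0 z hz
    rw [← hPQ z hz]
    simp only [Polynomial.eval_add, Polynomial.eval_mul, Polynomial.eval_C]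
    field_simp
  have hpoly : |(∑' j, w (j + n) * (z / (z + t (j + n)))) - p.eval z| ≤ S := by
    refine (hpz z hz).trans ((mul_le_mul_of_nonneg_left htail (by positivity)).trans ?_)
    have h3 : Real.exp M ≤ 3 ^ D := by
      calc Real.exp M ≤ Real.exp (D * 1) := by
            rw [mul_one]; exact Real.exp_le_exp.2 (Nat.le_ceil M)
        _ = Real.exp 1 ^ D := Real.exp_nat_mul 1 D
        _ ≤ 3 ^ D := by gcongr; linarith [Real.exp_one_lt_d9]
    rw [one_div, inv_pow, ← mul_assoc, ← div_eq_inv_mul]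
    exact mul_le_of_le_one_left hS0 ((div_le_one (by positivity)).2 h3)
  rw [heval]
  rcases hz.1.eq_or_lt with rfl | hz0
  · have hp0 : |p.eval 0| ≤ S := by simpa using hpoly
    rw [Real.zero_rpow h0.ne']
    simp only [zero_div, mul_zero, Finset.sum_const_zero, zero_add, sub_zero]
    rw [abs_mul, abs_of_pos hc0]
    calc c * |p.eval 0| ≤ c * (A + S) := by gcongr; linarith
      _ = _ := by rw [hc]; ring
  obtain ⟨hsum, hq⟩ := hquad (Real.log z + M)
  have hterm : ∀ j : ℕ, nodeTerm α (Real.log z + M) j = w j * (z / (z + t j)) := by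
    intro j
    have hd := hdens j
    have htj := ht j
    have e : Real.exp (logNode α j - (Real.log z + M)) = t j / z := by
      rw [← sub_sub, sub_right_comm, Real.exp_sub, Real.exp_log hz0]
    rw [nodeTerm, logKernel, e]
    simp only [w]
    field_simp
  rw [← hsum.sum_add_tsum_nat_add n] at hq
  simp only [hterm] at hq
  have hpow : z ^ α = c * (Real.exp (α * (Real.log z + M)) * K) := by
    rw [Real.rpow_def_of_pos hz0, hc, mul_add, Real.exp_add, Real.exp_neg, mul_comm α]
    field_simp
  rw [hpow, ← mul_sub, abs_mul, abs_of_pos hc0]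
  calc c * _ ≤ c * (A + S) := by
        refine mul_le_mul_of_nonneg_left ?_ hc0.le
        rw [abs_le] at hq hpoly ⊢
        constructor <;> linarith [hq.1, hq.2, hpoly.1, hpoly.2]
    _ = _ := by rw [hc]; ring

lemma buraError_zero_le_one {α : ℝ} (h0 : 0 < α) (k : ℕ) : buraError 0 α k ≤ 1 := by
  refine buraError_zero_le (P := 0) (Q := 1) (by simp) (by simp) (by simp) fun z hz => ?_
  rw [Polynomial.eval_zero, zero_div, zero_sub, abs_neg, abs_of_nonneg (Real.rpow_nonneg hz.1 _)]
  exact Real.rpow_le_one hz.1 hz.2 h0.le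

/-- Exponential decay of the BURA error: for every `α ∈ (0,1)` there is `C_α > 0` with
`E_{α,k} ≤ C_α e^{-2π√(kα)}` for all `k ≥ 1`. -/
theorem buraError_exponential_decay (α : ℝ) (hα : α ∈ Set.Ioo (0:ℝ) 1) :
    ∃ C : ℝ, 0 < C ∧ ∀ k : ℕ, 1 ≤ k →
      buraError 0 α k ≤ C * Real.exp (-2 * Real.pi * Real.sqrt (k * α)) := by
  obtain ⟨h0, h1⟩ := hα
  obtain ⟨B, hB, hbura⟩ := exists_buraError_le_exp h0 h1
  have hpi := Real.pi_gt_three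
  set a := Real.sqrt α / (2 * π) with ha
  have hs0 : 0 < Real.sqrt α := Real.sqrt_pos.2 h0
  have hs1 : Real.sqrt α ≤ 1 := Real.sqrt_le_one.2 h1.le
  have hsq : Real.sqrt α ^ 2 = α := Real.sq_sqrt h0.le
  have ha0 : 0 < a := by positivity
  have ha1 : a ≤ 1 := (div_le_one (by positivity)).2 (by linarith)
  set h := 11 / a + 1 with hh
  have hh2 : 12 ≤ h := by
    have : 11 ≤ 11 / a := by rw [le_div_iff₀ ha0]; linarith
    linarith
  refine ⟨(B + 1) * Real.exp (2 * π * Real.sqrt α * h), by positivity, fun k _ => ?_⟩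
  set s := Real.sqrt k with hs
  have hsk : s ^ 2 = k := Real.sq_sqrt (Nat.cast_nonneg k)
  rw [Real.sqrt_mul (Nat.cast_nonneg k), mul_assoc, ← Real.exp_add]
  rcases lt_or_ge s h with hlt | hge
  · refine (buraError_zero_le_one h0 k).trans ?_
    have : 0 ≤ 2 * π * Real.sqrt α * h + -2 * π * (s * Real.sqrt α) := by
      have : 0 ≤ 2 * π * Real.sqrt α * (h - s) := by
        have := sub_pos.2 hlt
        positivity
      linarith
    have := Real.one_le_exp this
    nlinarith
  · have hM : 0 ≤ (s - h) / a := div_nonneg (by linarith) ha0.le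
    have key := hbura ((s - h) / a) hM k (by
      have e1 : α / (4 * π ^ 2) * ((s - h) / a) ^ 2 = (s - h) ^ 2 := by
        have : α / (4 * π ^ 2) = a ^ 2 := by rw [ha, div_pow, hsq]; ring
        rw [this]; field_simp
      have e2 : 11 * ((s - h) / a) = (h - 1) * (s - h) := by rw [hh]; ring
      rw [e1, e2, ← hsk]
      nlinarith)
    have e3 : -(α * ((s - h) / a)) =
        2 * π * Real.sqrt α * h + -2 * π * (s * Real.sqrt α) := by
      have : α / a = 2 * π * Real.sqrt α := by
        rw [ha]; nth_rewrite 1 [← hsq]; field_simp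
      rw [mul_div_assoc', mul_div_right_comm, this]; ring
    rw [e3] at key
    refine key.trans ?_
    gcongr
    linarith
end

section
/- For every α ∈ (0,1) there exist positive constants c₁, c₂ and C such that for every k′ ∈ (0,1], setting M = ⌈c₁/k′²⌉ and N = ⌈c₂/k′²⌉, one has for every real λ ≥ 1: |λ^{−α} − (k′ sin(πα)/π) · Σ_{l=−M}^{N} e^{(1−α)l k′} (e^{l k′} + λ)^{−1}| ≤ C · e^{−π²/(2k′)} (exponential convergence of the truncated sinc quadrature approximation of the Balakrishnan integral). -/
open Real Set Finset

theorem Complex.integral_exp_mul_div_exp_add_one {s : ℂ} (hs₀ : 0 < s.re) (hs₁ : s.re < 1) :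
    ∫ y : ℝ, Complex.exp (s * y) / (Complex.exp y + 1) = π / Complex.sin (π * s) := by
  have hs₂ : 0 < (1 - s).re := by simpa using hs₁
  have hpoint : ∀ y : ℝ, Complex.exp (s * y) / (Complex.exp y + 1) =
      |sigmoid y * (1 - sigmoid y)| •
        ((sigmoid y : ℂ) ^ (s - 1) * (1 - (sigmoid y : ℂ)) ^ (1 - s - 1)) := by
    intro y
    set t := sigmoid (-y) with ht
    have htpos : 0 < t := sigmoid_pos _
    have htinv : t = (1 + Real.exp y)⁻¹ := by rw [ht, sigmoid_def, neg_neg]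
    have hsig : sigmoid y = Real.exp y * t := by
      rw [ht, ← sigmoid_mul_rexp_neg, mul_comm, mul_assoc, ← Real.exp_add]; simp
    have hone : 1 - sigmoid y = t := (sigmoid_neg y).symm
    have hone' : (1 : ℂ) - (sigmoid y : ℂ) = (t : ℂ) := by rw [← hone]; push_cast; ring
    have htc : (t : ℂ) ≠ 0 := by exact_mod_cast htpos.ne'
    have hlog : Complex.exp (Real.log t : ℂ) = t := by
      rw [← Complex.ofReal_exp, Real.exp_log htpos]
    have hcpow : ∀ z : ℂ, (t : ℂ) ^ z = Complex.exp (Real.log t * z) := fun z => by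
      rw [Complex.cpow_def_of_ne_zero htc, Complex.ofReal_log htpos.le]
    have hsc : (sigmoid y : ℂ) ^ (s - 1) = Complex.exp ((y + Real.log t) * (s - 1)) := by
      rw [Complex.cpow_def_of_ne_zero (by exact_mod_cast (sigmoid_pos y).ne'),
        ← Complex.ofReal_log (sigmoid_nonneg y), hsig,
        Real.log_mul (Real.exp_pos y).ne' htpos.ne', Real.log_exp]
      push_cast; rfl
    have hden : (Complex.exp y + 1)⁻¹ = (t : ℂ) := by
      rw [htinv]; push_cast; rw [add_comm]
    rw [abs_of_nonneg (mul_nonneg (sigmoid_nonneg y) (by rw [hone]; exact htpos.le)),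
      hone', hone, hsc, hcpow, hsig, Complex.real_smul, ← Complex.exp_add, div_eq_mul_inv, hden]
    push_cast
    have : (y + Real.log t : ℂ) * (s - 1) + Real.log t * (1 - s - 1) =
      s * y - y - Real.log t := by ring
    rw [this, Complex.exp_sub, Complex.exp_sub, hlog]
    field_simp [Complex.exp_ne_zero]
  calc ∫ y : ℝ, Complex.exp (s * y) / (Complex.exp y + 1)
      = ∫ y in (univ : Set ℝ), |sigmoid y * (1 - sigmoid y)| •
        ((sigmoid y : ℂ) ^ (s - 1) * (1 - (sigmoid y : ℂ)) ^ (1 - s - 1)) := by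
        rw [MeasureTheory.setIntegral_univ]; exact MeasureTheory.integral_congr_ae (.of_forall hpoint)
    _ = ∫ x in Ioo (0 : ℝ) 1, (x : ℂ) ^ (s - 1) * (1 - (x : ℂ)) ^ (1 - s - 1) := by
        rw [← MeasureTheory.integral_image_eq_integral_abs_deriv_smul MeasurableSet.univ
          (fun x _ => (hasDerivAt_sigmoid x).hasDerivWithinAt) sigmoid_injective.injOn
          (fun x : ℝ => (x : ℂ) ^ (s - 1) * (1 - (x : ℂ)) ^ (1 - s - 1)),
          image_univ, range_sigmoid]
    _ = Complex.betaIntegral s (1 - s) := by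
        rw [Complex.betaIntegral, intervalIntegral.integral_of_le zero_le_one,
          MeasureTheory.integral_Ioc_eq_integral_Ioo]
    _ = π / Complex.sin (π * s) := by
        rw [Complex.betaIntegral_eq_Gamma_mul_div _ _ hs₀ hs₂, Complex.Gamma_mul_Gamma_one_sub]
        simp

theorem Complex.abs_sinh_le_norm_sin (z : ℂ) : |Real.sinh z.im| ≤ ‖Complex.sin z‖ := by
  rw [← Real.sqrt_sq_eq_abs, Complex.norm_def]
  apply Real.sqrt_le_sqrt
  have h : Complex.sin z = ((Real.sin z.re * Real.cosh z.im : ℝ) : ℂ) +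
      ((Real.cos z.re * Real.sinh z.im : ℝ) : ℂ) * Complex.I := by
    rw [Complex.sin_eq]; push_cast; ring
  rw [h, Complex.normSq_add_mul_I]
  nlinarith [Real.sin_sq_add_cos_sq z.re, Real.cosh_sq z.im, sq_nonneg (Real.sin z.re)]

theorem Real.summable_exp_neg_mul_abs_int {a : ℝ} (ha : 0 < a) :
    Summable fun n : ℤ => Real.exp (-a * |(n : ℝ)|) := by
  have h : Summable fun n : ℕ => Real.exp (-a * n) := by
    simpa [mul_comm] using Real.summable_exp_nat_mul_iff.mpr (neg_lt_zero.mpr ha)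
  exact Summable.of_nat_of_neg (by simpa using h) (by simpa using h)

theorem Real.tsum_exp_neg_mul_abs_int_le {a : ℝ} (ha : 0 < a) :
    ∑' n : ℤ, Real.exp (-a * |(n : ℝ)|) ≤ 2 * (1 + 1 / a) := by
  have hr : Real.exp (-a) < 1 := by simpa using ha
  have h : HasSum (fun n : ℕ => Real.exp (-a * n)) (1 - Real.exp (-a))⁻¹ := by
    convert hasSum_geometric_of_lt_one (Real.exp_pos (-a)).le hr using 2 with n
    rw [← Real.exp_nat_mul, mul_comm]
  have h2 := HasSum.of_nat_of_neg (f := fun n : ℤ => Real.exp (-a * |(n : ℝ)|))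
    (by simpa using h) (by simpa using h)
  refine h2.tsum_eq.trans_le ?_
  have h3 : (1 - Real.exp (-a))⁻¹ ≤ 1 + 1 / a := by
    have : Real.exp (-a) ≤ (1 + a)⁻¹ := by
      rw [Real.exp_neg]
      exact inv_anti₀ (by positivity) (by linarith [Real.add_one_le_exp a])
    have h4 : (1 + 1 / a)⁻¹ = 1 - (1 + a)⁻¹ := by field_simp; ring
    rw [inv_le_comm₀ (by linarith) (by positivity), h4]
    linarith
  refine (sub_le_self _ (Real.exp_pos _).le).trans ?_
  linarith

open scoped FourierTransform in
theorem fourier_exp_div_exp_add {β k lam : ℝ} (hβ₀ : 0 < β) (hβ₁ : β < 1) (hk : 0 < k)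
    (hlam : 0 < lam) (ξ : ℝ) :
    𝓕 (fun x : ℝ => ((Real.exp (β * x * k) * (Real.exp (x * k) + lam)⁻¹ : ℝ) : ℂ)) ξ =
      (k : ℂ)⁻¹ * (Complex.exp ((β - 2 * π * ξ / k * Complex.I) * Real.log lam) / lam *
        (π / Complex.sin (π * (β - 2 * π * ξ / k * Complex.I)))) := by
  set s : ℂ := β - 2 * π * ξ / k * Complex.I with hs
  set L := Real.log lam with hL
  have hlamc : (lam : ℂ) ≠ 0 := by exact_mod_cast hlam.ne'
  have hkc : (k : ℂ) ≠ 0 := by exact_mod_cast hk.ne'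
  have hre : s.re = β := by
    rw [hs, show (2 * π * ξ / k : ℂ) = ((2 * π * ξ / k : ℝ) : ℂ) by push_cast; rfl]; simp
  have hexpL : Complex.exp L = lam := by rw [← Complex.ofReal_exp, hL, Real.exp_log hlam]
  rw [Real.fourier_real_eq_integral_exp_smul]
  have hpoint : ∀ x : ℝ, Complex.exp ((-2 * π * x * ξ : ℝ) * Complex.I) •
      ((Real.exp (β * x * k) * (Real.exp (x * k) + lam)⁻¹ : ℝ) : ℂ) =
      Complex.exp (s * L) / lam * (fun z : ℝ => (fun y : ℝ =>
        Complex.exp (s * y) / (Complex.exp y + 1)) (z - L)) (k * x) := by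
    intro x
    have h1 : (Complex.exp (k * x - L : ℝ) + 1) = (Complex.exp (x * k) + lam) / lam := by
      push_cast
      rw [Complex.exp_sub, hexpL, mul_comm (k : ℂ)]; field_simp
    have h2 : Complex.exp (x * k) + lam ≠ 0 := by
      have : (0 : ℝ) < Real.exp (x * k) + lam := by positivity
      exact_mod_cast this.ne'
    simp only
    rw [h1]
    push_cast
    rw [mul_sub, Complex.exp_sub, smul_eq_mul, ← mul_assoc, ← Complex.exp_add]
    have h3 : (-2 * π * x * ξ : ℂ) * Complex.I + β * x * k = s * (k * x) := by
      rw [hs]; field_simp; ring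
    rw [h3]
    field_simp [Complex.exp_ne_zero]
  rw [MeasureTheory.integral_congr_ae (.of_forall hpoint), MeasureTheory.integral_const_mul,
    MeasureTheory.Measure.integral_comp_mul_left (fun z : ℝ => (fun y : ℝ =>
      Complex.exp (s * y) / (Complex.exp y + 1)) (z - L)),
    MeasureTheory.integral_sub_right_eq_self
      (fun y : ℝ => Complex.exp (s * y) / (Complex.exp y + 1)) L,
    Complex.integral_exp_mul_div_exp_add_one (by rwa [hre]) (by rwa [hre]),
    abs_of_pos (inv_pos.mpr hk), Complex.real_smul]
  push_cast
  ring

theorem exp_mul_inv_exp_add_le {β γ lam : ℝ} (hγ₀ : γ ≤ β) (hγ₁ : γ ≤ 1 - β) (hlam : 1 ≤ lam)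
    (x k : ℝ) (hk : 0 < k) :
    Real.exp (β * x * k) * (Real.exp (x * k) + lam)⁻¹ ≤ Real.exp (-(γ * k) * |x|) := by
  rw [← div_eq_mul_inv, div_le_iff₀ (by positivity)]
  have hpos := Real.exp_pos (-(γ * k) * |x|)
  rcases le_total 0 x with hx | hx
  · calc Real.exp (β * x * k) ≤ Real.exp (-(γ * k) * |x|) * Real.exp (x * k) := by
          rw [← Real.exp_add, Real.exp_le_exp, abs_of_nonneg hx]
          nlinarith [mul_nonneg hx hk.le]
      _ ≤ _ := by gcongr; linarith
  · calc Real.exp (β * x * k) ≤ Real.exp (-(γ * k) * |x|) := by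
          rw [Real.exp_le_exp, abs_of_nonpos hx]
          nlinarith [mul_nonneg (neg_nonneg.mpr hx) hk.le]
      _ ≤ _ := by
          apply le_mul_of_one_le_right hpos.le
          linarith [Real.exp_pos (x * k)]

theorem summable_exp_mul_inv_exp_add {β k lam : ℝ} (hβ₀ : 0 < β) (hβ₁ : β < 1) (hk : 0 < k)
    (hlam : 1 ≤ lam) :
    Summable fun l : ℤ => Real.exp (β * (l : ℝ) * k) * (Real.exp ((l : ℝ) * k) + lam)⁻¹ :=
  (Real.summable_exp_neg_mul_abs_int
    (mul_pos (lt_min hβ₀ (sub_pos.mpr hβ₁)) hk)).of_nonneg_of_le (fun l => by positivity)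
    fun l => exp_mul_inv_exp_add_le (min_le_left _ _) (min_le_right _ _) hlam _ _ hk

open scoped FourierTransform in
theorem norm_fourier_exp_div_exp_add_le {β k lam : ℝ} (hβ₀ : 0 < β) (hβ₁ : β < 1)
    (hk : k ∈ Ioc (0 : ℝ) 1) (hlam : 1 ≤ lam) {n : ℤ} (hn : n ≠ 0) :
    ‖𝓕 (fun x : ℝ => ((Real.exp (β * x * k) * (Real.exp (x * k) + lam)⁻¹ : ℝ) : ℂ)) (n : ℝ)‖ ≤
      4 * π / k * Real.exp (-π ^ 2 / (2 * k)) * Real.exp (-(π ^ 2 / k) * |(n : ℝ)|) := by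
  obtain ⟨hk₀, hk₁⟩ := hk
  have hlam₀ : 0 < lam := by linarith
  have hn₁ : (1 : ℝ) ≤ |(n : ℝ)| := by exact_mod_cast Int.one_le_abs hn
  have hpi := Real.pi_gt_three
  rw [fourier_exp_div_exp_add hβ₀ hβ₁ hk₀ hlam₀]
  set w : ℝ := 2 * π * n / k with hw
  have hwc : (2 * π * (n : ℝ) / k : ℂ) = (w : ℂ) := by rw [hw]; push_cast; rfl
  rw [hwc]
  set t : ℝ := 2 * (π ^ 2 / k) * |(n : ℝ)| with ht
  have hpk : 1 ≤ π ^ 2 / k := by rw [le_div_iff₀ hk₀]; nlinarith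
  have ht₁ : 1 ≤ t := by nlinarith
  have hexp : ‖Complex.exp ((β - w * Complex.I) * Real.log lam) / lam‖ ≤ 1 := by
    rw [norm_div, Complex.norm_exp, Complex.norm_real, Real.norm_of_nonneg hlam₀.le,
      div_le_one hlam₀]
    refine le_of_le_of_eq (Real.exp_le_exp.mpr ?_) (Real.exp_log hlam₀)
    simp
    nlinarith [Real.log_nonneg hlam]
  have hsinh : Real.exp t / 4 ≤ ‖Complex.sin (π * (β - w * Complex.I))‖ := by
    refine le_trans ?_ (Complex.abs_sinh_le_norm_sin _)
    have him : (π * (β - w * Complex.I) : ℂ).im = -(π * w) := by simp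
    have habs : |-(π * w)| = t := by
      rw [abs_neg, abs_mul, hw, abs_div, abs_mul, abs_mul, abs_of_pos hk₀,
        abs_of_pos Real.pi_pos, abs_two, ht]; ring
    rw [him, Real.abs_sinh, habs, Real.sinh_eq]
    have h1 := Real.add_one_le_exp t
    have h2 : Real.exp (-t) ≤ 1 := by rw [Real.exp_le_one_iff]; linarith
    linarith
  have hdecay : Real.exp (-t) ≤
      Real.exp (-π ^ 2 / (2 * k)) * Real.exp (-(π ^ 2 / k) * |(n : ℝ)|) := by
    rw [← Real.exp_add, Real.exp_le_exp, ht,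
      show -π ^ 2 / (2 * k) = -(π ^ 2 / k) / 2 by field_simp]
    nlinarith
  rw [norm_mul, norm_mul, norm_div (π : ℂ), norm_inv, Complex.norm_real, Complex.norm_real,
    Real.norm_of_nonneg hk₀.le, Real.norm_of_nonneg Real.pi_pos.le]
  calc k⁻¹ * (‖Complex.exp ((β - w * Complex.I) * Real.log lam) / lam‖ *
        (π / ‖Complex.sin (π * (β - w * Complex.I))‖))
      ≤ k⁻¹ * (1 * (π / (Real.exp t / 4))) := by gcongr
    _ = 4 * π / k * Real.exp (-t) := by rw [Real.exp_neg]; field_simp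
    _ ≤ _ := by rw [mul_assoc]; gcongr

open scoped FourierTransform in
theorem abs_mul_tsum_exp_div_exp_add_sub_le {β k lam : ℝ} (hβ₀ : 0 < β) (hβ₁ : β < 1)
    (hk : k ∈ Ioc (0 : ℝ) 1) (hlam : 1 ≤ lam) :
    |k * ∑' l : ℤ, Real.exp (β * (l : ℝ) * k) * (Real.exp ((l : ℝ) * k) + lam)⁻¹ -
      π / Real.sin (π * β) * lam ^ (β - 1)| ≤ 16 * π * Real.exp (-π ^ 2 / (2 * k)) := by
  have hk₀ := hk.1
  have hk₁ := hk.2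
  have hlam₀ : 0 < lam := by linarith
  have hpi := Real.pi_gt_three
  have hpk : 1 ≤ π ^ 2 / k := by rw [le_div_iff₀ hk₀]; nlinarith
  set g : ℝ → ℂ := fun x : ℝ =>
    ((Real.exp (β * x * k) * (Real.exp (x * k) + lam)⁻¹ : ℝ) : ℂ) with hg
  have hcont : Continuous g := by
    refine Complex.continuous_ofReal.comp (Continuous.mul (by fun_prop) ?_)
    exact Continuous.inv₀ (by fun_prop) fun x => by positivity
  have hdecay : g =O[Filter.cocompact ℝ] fun x : ℝ => |x| ^ (-2 : ℝ) := by
    have hγ : 0 < min β (1 - β) * k := mul_pos (lt_min hβ₀ (sub_pos.mpr hβ₁)) hk₀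
    have h := (isLittleO_exp_neg_mul_rpow_atTop hγ (-2)).isBigO.comp_tendsto
      (tendsto_norm_cocompact_atTop (E := ℝ))
    refine Asymptotics.IsBigO.trans (Asymptotics.IsBigO.of_norm_le fun x => ?_) h
    rw [hg, Complex.norm_real, Real.norm_of_nonneg (by positivity)]
    exact exp_mul_inv_exp_add_le (min_le_left _ _) (min_le_right _ _) hlam x k hk₀
  set E := Real.exp (-π ^ 2 / (2 * k)) with hE
  have hsum₀ := (Real.summable_exp_neg_mul_abs_int (zero_lt_one.trans_le hpk)).mul_left
    (4 * π / k * E)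
  have hbound : ∀ n : ℤ, ‖if n = 0 then (0 : ℂ) else 𝓕 g n‖ ≤
      4 * π / k * E * Real.exp (-(π ^ 2 / k) * |(n : ℝ)|) := by
    intro n
    split_ifs with hn
    · rw [norm_zero]; positivity
    · exact norm_fourier_exp_div_exp_add_le hβ₀ hβ₁ hk hlam hn
  have hsumF : Summable fun n : ℤ => 𝓕 g n := by
    refine (Summable.of_norm_bounded hsum₀ hbound).congr_cofinite ?_
    filter_upwards [(Set.finite_singleton (0 : ℤ)).compl_mem_cofinite] with n hn
    exact if_neg hn
  have hpoisson := Real.tsum_eq_tsum_fourier_of_rpow_decay_of_summable hcont one_lt_two hdecay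
    hsumF 0
  have hzero : 𝓕 g ((0 : ℤ) : ℝ) =
      ((k⁻¹ * (π / Real.sin (π * β) * lam ^ (β - 1)) : ℝ) : ℂ) := by
    rw [hg, fourier_exp_div_exp_add hβ₀ hβ₁ hk₀ hlam₀, Real.rpow_sub_one hlam₀.ne',
      Real.rpow_def_of_pos hlam₀]
    push_cast
    simp only [mul_zero, zero_div, zero_mul, sub_zero]
    ring_nf
  have hpoisson' : ((∑' l : ℤ,
      Real.exp (β * (l : ℝ) * k) * (Real.exp ((l : ℝ) * k) + lam)⁻¹ : ℝ) : ℂ) =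
      𝓕 g ((0 : ℤ) : ℝ) + ∑' n : ℤ, if n = 0 then (0 : ℂ) else 𝓕 g n := by
    rw [← hsumF.tsum_eq_add_tsum_ite 0, Complex.ofReal_tsum]
    simpa [hg] using hpoisson
  have hnorm : ‖∑' n : ℤ, if n = 0 then (0 : ℂ) else 𝓕 g n‖ ≤ 4 * π / k * E * 4 := by
    refine (tsum_of_norm_bounded hsum₀.hasSum hbound).trans ?_
    rw [tsum_mul_left]
    gcongr
    refine (Real.tsum_exp_neg_mul_abs_int_le (zero_lt_one.trans_le hpk)).trans ?_
    have : 1 / (π ^ 2 / k) ≤ 1 := by rw [div_le_one (by linarith)]; exact hpk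
    linarith
  set S := ∑' l : ℤ, Real.exp (β * (l : ℝ) * k) * (Real.exp ((l : ℝ) * k) + lam)⁻¹
  have hdiff : |S - k⁻¹ * (π / Real.sin (π * β) * lam ^ (β - 1))| ≤ 4 * π / k * E * 4 := by
    rw [← Real.norm_eq_abs, ← Complex.norm_real, Complex.ofReal_sub, hpoisson', hzero,
      add_sub_cancel_left]
    exact hnorm
  have hfac : k * S - π / Real.sin (π * β) * lam ^ (β - 1) =
      k * (S - k⁻¹ * (π / Real.sin (π * β) * lam ^ (β - 1))) := by field_simp
  rw [hfac, abs_mul, abs_of_pos hk₀]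
  calc _ ≤ k * (4 * π / k * E * 4) := by gcongr
    _ = _ := by field_simp; ring

theorem abs_tsum_sub_sum_Icc_exp_div_exp_add_le {β γ k lam : ℝ} (hγ : 0 < γ) (hγ₀ : γ ≤ β)
    (hγ₁ : γ ≤ 1 - β) (hk : 0 < k) (hlam : 1 ≤ lam) {M : ℤ} (hM : π ^ 2 / γ / k ^ 2 ≤ M) :
    |∑' l : ℤ, Real.exp (β * (l : ℝ) * k) * (Real.exp ((l : ℝ) * k) + lam)⁻¹ -
      ∑ l ∈ Finset.Icc (-M) M, Real.exp (β * (l : ℝ) * k) * (Real.exp ((l : ℝ) * k) + lam)⁻¹| ≤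
      Real.exp (-π ^ 2 / (2 * k)) * (2 * (1 + 1 / (γ * k / 2))) := by
  have ha : 0 < γ * k / 2 := by positivity
  set φ : ℤ → ℝ := fun l =>
    Real.exp (β * (l : ℝ) * k) * (Real.exp ((l : ℝ) * k) + lam)⁻¹ with hφ
  have hsum : Summable φ :=
    summable_exp_mul_inv_exp_add (hγ.trans_le hγ₀) (by linarith) hk hlam
  have hsum₀ := (Real.summable_exp_neg_mul_abs_int ha).mul_left (Real.exp (-π ^ 2 / (2 * k)))
  have htail : ∀ l : ℤ, ‖φ l - (if l ∈ Finset.Icc (-M) M then φ l else 0)‖ ≤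
      Real.exp (-π ^ 2 / (2 * k)) * Real.exp (-(γ * k / 2) * |(l : ℝ)|) := by
    intro l
    split_ifs with hl
    · rw [sub_self, norm_zero]; positivity
    · rw [sub_zero, Real.norm_of_nonneg (by positivity)]
      refine (exp_mul_inv_exp_add_le hγ₀ hγ₁ hlam l k hk).trans ?_
      have hlM : (M : ℝ) ≤ |(l : ℝ)| := by
        rw [Finset.mem_Icc, ← abs_le, not_le] at hl
        exact_mod_cast hl.le
      have h : π ^ 2 / k ≤ γ * k * |(l : ℝ)| := by
        calc π ^ 2 / k = γ * k * (π ^ 2 / γ / k ^ 2) := by field_simp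
          _ ≤ _ := by gcongr; exact hM.trans hlM
      rw [← Real.exp_add, Real.exp_le_exp,
        show -π ^ 2 / (2 * k) = -(π ^ 2 / k) / 2 by field_simp]
      linarith
  have hite : HasSum (fun l => if l ∈ Finset.Icc (-M) M then φ l else 0)
      (∑ l ∈ Finset.Icc (-M) M, φ l) := by
    rw [← Finset.sum_congr rfl fun l hl => if_pos hl]
    exact hasSum_sum_of_ne_finset_zero fun l hl => if_neg hl
  rw [← (hsum.hasSum.sub hite).tsum_eq, ← Real.norm_eq_abs]
  refine (tsum_of_norm_bounded hsum₀.hasSum htail).trans ?_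
  rw [tsum_mul_left]
  gcongr
  exact Real.tsum_exp_neg_mul_abs_int_le ha

/-- Exponential convergence of the truncated sinc quadrature approximation of the
Balakrishnan integral: for every `α ∈ (0,1)` there are constants `c₁, c₂, C > 0` such that
for all `k' ∈ (0,1]`, with `M = ⌈c₁/k'²⌉` and `N = ⌈c₂/k'²⌉`, for every `λ ≥ 1`,
`|λ^{-α} - (k' sin(πα)/π) Σ_{l=-M}^{N} e^{(1-α) l k'} (e^{l k'} + λ)⁻¹| ≤ C e^{-π²/(2k')}`. -/
theorem sinc_quadrature_exponential_convergence (α : ℝ) (hα : α ∈ Set.Ioo (0:ℝ) 1) :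
    ∃ c₁ c₂ C : ℝ, 0 < c₁ ∧ 0 < c₂ ∧ 0 < C ∧
      ∀ k' : ℝ, k' ∈ Set.Ioc (0:ℝ) 1 →
        ∀ lam : ℝ, 1 ≤ lam →
          |lam ^ (-α) -
              (k' * Real.sin (Real.pi * α) / Real.pi) *
                ∑ l ∈ Finset.Icc (-(⌈c₁ / k' ^ 2⌉ : ℤ)) ⌈c₂ / k' ^ 2⌉,
                  Real.exp ((1 - α) * (l : ℝ) * k') * (Real.exp ((l : ℝ) * k') + lam)⁻¹| ≤
            C * Real.exp (-Real.pi ^ 2 / (2 * k')) := by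
  obtain ⟨hα₀, hα₁⟩ := hα
  set γ := min (1 - α) α
  have hγ : 0 < γ := lt_min (by linarith) hα₀
  have hsin : 0 < Real.sin (π * α) :=
    Real.sin_pos_of_pos_of_lt_pi (by positivity) (by nlinarith [Real.pi_pos])
  refine ⟨π ^ 2 / γ, π ^ 2 / γ, 16 + (2 + 4 / γ), by positivity, by positivity, by positivity,
    fun k hk lam hlam => ?_⟩
  have hk₀ := hk.1
  have hP := abs_mul_tsum_exp_div_exp_add_sub_le (β := 1 - α) (by linarith) (by linarith) hk hlam
  have hT := abs_tsum_sub_sum_Icc_exp_div_exp_add_le (β := 1 - α) hγ (min_le_left _ _)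
    ((min_le_right _ _).trans_eq (sub_sub_cancel 1 α).symm) hk₀ hlam (Int.le_ceil _)
  set S := ∑' l : ℤ, Real.exp ((1 - α) * (l : ℝ) * k) * (Real.exp ((l : ℝ) * k) + lam)⁻¹
  set F := ∑ l ∈ Finset.Icc (-(⌈π ^ 2 / γ / k ^ 2⌉ : ℤ)) ⌈π ^ 2 / γ / k ^ 2⌉,
    Real.exp ((1 - α) * (l : ℝ) * k) * (Real.exp ((l : ℝ) * k) + lam)⁻¹
  set E := Real.exp (-π ^ 2 / (2 * k))
  have hE : 0 < E := Real.exp_pos _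
  rw [show π * (1 - α) = π - π * α by ring, Real.sin_pi_sub, show 1 - α - 1 = -α by ring] at hP
  set q := Real.sin (π * α) / π with hq
  have hq₀ : 0 < q := by positivity
  have hqπ : q * π ≤ 1 := by
    rw [hq, div_mul_cancel₀ _ Real.pi_ne_zero]; exact Real.sin_le_one _
  have hq₁ : q ≤ 1 := by nlinarith [Real.pi_gt_three]
  have hsplit : lam ^ (-α) - k * Real.sin (π * α) / π * F =
      -(q * (k * S - π / Real.sin (π * α) * lam ^ (-α))) + q * (k * (S - F)) := by
    have h : q * (π / Real.sin (π * α)) = 1 :=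
      div_mul_div_cancel₀' hsin.ne' _ _ |>.trans (div_self Real.pi_ne_zero)
    rw [mul_div_assoc, ← hq]
    linear_combination -(lam ^ (-α)) * h
  have hkT : k * |S - F| ≤ E * (2 + 4 / γ) := by
    calc k * |S - F| ≤ k * (E * (2 * (1 + 1 / (γ * k / 2)))) := by gcongr
      _ = E * (2 * k + 4 / γ) := by field_simp; ring
      _ ≤ _ := by gcongr; linarith [hk.2]
  rw [hsplit]
  refine (abs_add_le _ _).trans ?_
  rw [abs_neg, abs_mul, abs_mul, abs_mul, abs_of_pos hq₀, abs_of_pos hk₀]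
  have h1 : q * |k * S - π / Real.sin (π * α) * lam ^ (-α)| ≤ 16 * E := by
    calc _ ≤ q * (16 * π * E) := by gcongr
      _ = 16 * (q * π) * E := by ring
      _ ≤ 16 * 1 * E := by gcongr
      _ = 16 * E := by ring
  have h2 : q * (k * |S - F|) ≤ E * (2 + 4 / γ) :=
    (mul_le_of_le_one_left (by positivity) hq₁).trans hkT
  linarith
end
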